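/- arXiv:math/0607564 — 15 statements merged into one kernel-verified Lean document; each statement's English description precedes it below -/
import Mathlib

section
/- Let S be a semigroup in which any two idempotent elements commute. If t is an inverse of a and u is an inverse of b (that is, a*t*a = a, t*a*t = t, b*u*b = b, u*b*u = u), then u*t is an inverse of a*b: (a*b)*(u*t)*(a*b) = a*b and (u*t)*(a*b)*(u*t) = u*t. In particular, the product of two regular elements is regular. -/
/-- In a semigroup with commuting idempotents, if `t` is an inverse of `a` and `u` is an
inverse of `b`, then `u * t` is an inverse of `a * b`.  In particular the product of two
regular elements is regular. -/
theorem mul_inverse_of_idempotents_commute {S : Type*} [Semigroup S]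
    (hcomm : ∀ e f : S, e * e = e → f * f = f → e * f = f * e)
    (a t b u : S)
    (ha1 : a * t * a = a) (ha2 : t * a * t = t)
    (hb1 : b * u * b = b) (hb2 : u * b * u = u) :
    (a * b) * (u * t) * (a * b) = a * b ∧ (u * t) * (a * b) * (u * t) = u * t := by
  have h : b * u * (t * a) = t * a * (b * u) :=
    hcomm _ _ (by rw [← mul_assoc, hb1]) (by rw [← mul_assoc, ha2])
  constructor
  · calc a * b * (u * t) * (a * b) = a * (b * u * (t * a)) * b := by simp only [mul_assoc]
      _ = a * t * a * (b * u * b) := by rw [h]; simp only [mul_assoc]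
      _ = a * b := by rw [ha1, hb1]
  · calc u * t * (a * b) * (u * t) = u * (t * a * (b * u)) * t := by simp only [mul_assoc]
      _ = u * b * u * (t * a * t) := by rw [← h]; simp only [mul_assoc]
      _ = u * t := by rw [hb2, ha2]
end

section
/- Let S be a semigroup in which any two idempotent elements commute, let u be a regular element with inverse u' (u*u'*u = u and u'*u*u' = u'), and let s be any element of S. Then the following four conditions are equivalent: (1) u*u'*s = u; (2) there exists an idempotent e with u = e*s; (3) s*u'*u = u; (4) there exists an idempotent f with u = s*f. -/
/-- In a semigroup with commuting idempotents, for a regular element `u` with inverse `u'`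
and any element `s`, the four conditions `u * u' * s = u`, `u = e * s` for some idempotent
`e`, `s * u' * u = u`, and `u = s * f` for some idempotent `f` are equivalent. -/
theorem regular_below_tfae {S : Type*} [Semigroup S]
    (hcomm : ∀ e f : S, e * e = e → f * f = f → e * f = f * e)
    (u u' s : S)
    (hu1 : u * u' * u = u) (hu2 : u' * u * u' = u') :
    [u * u' * s = u,
     ∃ e : S, e * e = e ∧ u = e * s,
     s * u' * u = u,
     ∃ f : S, f * f = f ∧ u = s * f].TFAE := by
  have hl : u * u' * (u * u') = u * u' := by rw [← mul_assoc, hu1]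
  have hr : u' * u * (u' * u) = u' * u := by rw [← mul_assoc, hu2]
  tfae_have 1 → 2 := fun h => ⟨u * u', hl, h.symm⟩
  tfae_have 2 → 1 := by
    rintro ⟨e, he, hs⟩
    have heu : e * u = u := by rw [hs, ← mul_assoc, he]
    have hue : u * u' * e = u * u' := by
      rw [← hcomm e (u * u') he hl, ← mul_assoc, heu]
    calc u * u' * s = u * u' * e * s := by rw [hue]
      _ = u * u' * u := by rw [mul_assoc (u * u'), ← hs]
      _ = u := hu1
  tfae_have 3 → 4 := fun h => ⟨u' * u, hr, by rw [← mul_assoc, h]⟩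
  tfae_have 4 → 3 := by
    rintro ⟨f, hf, hs⟩
    have huf : u * f = u := by rw [hs, mul_assoc, hf]
    have hfu : f * (u' * u) = u' * u := by
      rw [hcomm f (u' * u) hf hr, mul_assoc, huf]
    calc s * u' * u = s * (f * (u' * u)) := by rw [hfu, mul_assoc]
      _ = u * (u' * u) := by rw [← mul_assoc, ← hs]
      _ = u := by rw [← mul_assoc, hu1]
  tfae_have 1 → 3 := by
    intro h
    have hs : u' * s = u' * u := by
      calc u' * s = u' * (u * u' * s) := by rw [← mul_assoc, ← mul_assoc, hu2]
        _ = u' * u := by rw [h]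
    have hi : s * u' * (s * u') = s * u' := by
      rw [mul_assoc, ← mul_assoc u', hs, hu2]
    have hc := hcomm (s * u') (u * u') hi hl
    rw [← mul_assoc (u * u'), h, mul_assoc s, ← mul_assoc u', hu2] at hc
    rw [hc, hu1]
  tfae_have 3 → 1 := by
    intro h
    have hs : s * u' = u * u' := by
      calc s * u' = s * u' * u * u' := by
            rw [mul_assoc s, mul_assoc s, hu2]
        _ = u * u' := by rw [h]
    have hi : u' * s * (u' * s) = u' * s := by
      rw [mul_assoc, ← mul_assoc s, hs, ← mul_assoc, ← mul_assoc, hu2]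
    have hc := hcomm (u' * s) (u' * u) hi hr
    rw [mul_assoc u' s, ← mul_assoc s, h, ← mul_assoc (u' * u), hu2] at hc
    rw [mul_assoc, ← hc, ← mul_assoc, hu1]
  tfae_finish
end

section
/- Let M be an inverse monoid, i.e. a monoid equipped with a map inv : M → M satisfying s * inv s * s = s and inv s * s * inv s = inv s for all s, and in which any two idempotents commute. Write u ≤ v to mean u = e*v for some idempotent e (the natural partial order). Then for all s, t, u ∈ M with u ≤ s*t, there exists a unique pair (a, b) ∈ M × M such that a ≤ s, b ≤ t, inv a * a = b * inv b, and a*b = u. -/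
section InverseMonoid

variable {M : Type*} [Monoid M] {inv : M → M}

theorem inverse_unique_of_idempotents_comm
    (hcomm : ∀ e f : M, e * e = e → f * f = f → e * f = f * e)
    {s x y : M} (hx₁ : s * x * s = s) (hx₂ : x * s * x = x)
    (hy₁ : s * y * s = s) (hy₂ : y * s * y = y) : x = y := by
  have hsx : (s * x) * (s * x) = s * x := by rw [← mul_assoc, hx₁]
  have hsy : (s * y) * (s * y) = s * y := by rw [← mul_assoc, hy₁]
  have hxs : (x * s) * (x * s) = x * s := by rw [← mul_assoc, hx₂]
  have hys : (y * s) * (y * s) = y * s := by rw [← mul_assoc, hy₂]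
  calc x = x * (s * x) := by rw [← mul_assoc, hx₂]
    _ = x * ((s * y) * (s * x)) := by rw [← mul_assoc (s * y), hy₁]
    _ = x * ((s * x) * (s * y)) := by rw [hcomm _ _ hsy hsx]
    _ = x * s * y := by rw [← mul_assoc (s * x), hx₁, mul_assoc]
    _ = (x * s) * (y * s) * y := by rw [mul_assoc (x * s), hy₂]
    _ = (y * s) * (x * s) * y := by rw [hcomm _ _ hxs hys]
    _ = y * (s * x * s) * y := by simp only [mul_assoc]
    _ = y := by rw [hx₁, hy₂]

theorem inv_mul_rev_of_idempotents_comm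
    (hinv1 : ∀ s : M, s * inv s * s = s) (hinv2 : ∀ s : M, inv s * s * inv s = inv s)
    (hcomm : ∀ e f : M, e * e = e → f * f = f → e * f = f * e) (a b : M) :
    inv (a * b) = inv b * inv a := by
  have h : (inv a * a) * (b * inv b) = (b * inv b) * (inv a * a) :=
    hcomm _ _ (by rw [← mul_assoc, hinv2]) (by rw [← mul_assoc, hinv1])
  refine inverse_unique_of_idempotents_comm hcomm (hinv1 _) (hinv2 _) ?_ ?_
  · calc a * b * (inv b * inv a) * (a * b) = a * ((b * inv b) * (inv a * a)) * b := by
          simp only [mul_assoc]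
      _ = (a * inv a * a) * (b * inv b * b) := by rw [← h]; simp only [mul_assoc]
      _ = a * b := by rw [hinv1, hinv1]
  · calc inv b * inv a * (a * b) * (inv b * inv a)
          = inv b * ((inv a * a) * (b * inv b)) * inv a := by simp only [mul_assoc]
      _ = (inv b * b * inv b) * (inv a * a * inv a) := by rw [h]; simp only [mul_assoc]
      _ = inv b * inv a := by rw [hinv2, hinv2]

theorem mul_inv_mul_eq_of_eq_idempotent_mul
    (hinv1 : ∀ s : M, s * inv s * s = s)
    (hcomm : ∀ e f : M, e * e = e → f * f = f → e * f = f * e)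
    {a s e : M} (he : e * e = e) (ha : a = e * s) : a * inv a * s = a := by
  have hea : e * a = a := by rw [ha, ← mul_assoc, he]
  have haa : (a * inv a) * (a * inv a) = a * inv a := by rw [← mul_assoc, hinv1]
  calc a * inv a * s = e * (a * inv a) * s := by rw [← mul_assoc e, hea]
    _ = a * inv a * (e * s) := by rw [hcomm _ _ he haa, mul_assoc]
    _ = a := by rw [← ha, hinv1]

theorem mul_inv_mul_mul_inv_of_eq_idempotent_mul
    (hinv1 : ∀ s : M, s * inv s * s = s) (hinv2 : ∀ s : M, inv s * s * inv s = inv s)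
    (hcomm : ∀ e f : M, e * e = e → f * f = f → e * f = f * e)
    {s t u e : M} (he : e * e = e) (hu : u = e * (s * t)) :
    u * inv u * s * (t * inv t) = u * inv u * s := by
  have htt : (t * inv t) * (t * inv t) = t * inv t := by rw [← mul_assoc, hinv1]
  have hss : (s * inv s) * (s * inv s) = s * inv s := by rw [← mul_assoc, hinv1]
  have hinve : inv e = e := inverse_unique_of_idempotents_comm hcomm (hinv1 e) (hinv2 e)
    (by rw [he, he]) (by rw [he, he])
  have hses : (inv s * e * s) * (inv s * e * s) = inv s * e * s := by
    calc (inv s * e * s) * (inv s * e * s) = inv s * (e * (s * inv s)) * e * s := by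
          simp only [mul_assoc]
      _ = (inv s * s * inv s) * (e * e) * s := by
          rw [hcomm _ _ he hss]; simp only [mul_assoc]
      _ = inv s * e * s := by rw [hinv2, he]
  have hus : u * inv u * s = e * s * ((t * inv t) * (inv s * e * s)) := by
    rw [hu, inv_mul_rev_of_idempotents_comm hinv1 hinv2 hcomm,
      inv_mul_rev_of_idempotents_comm hinv1 hinv2 hcomm, hinve]
    simp only [mul_assoc]
  rw [hus, hcomm _ _ htt hses, mul_assoc (e * s), mul_assoc (inv s * e * s), htt]

end InverseMonoid


/-- In an inverse monoid (monoid with an involution map `inv` satisfying the inverse axioms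
and commuting idempotents), every element `u` below a product `s * t` in the natural
partial order factors uniquely as `u = a * b` with `a ≤ s`, `b ≤ t` and
`inv a * a = b * inv b`. -/
theorem unique_factorization_below_product {M : Type*} [Monoid M]
    (inv : M → M)
    (hinv1 : ∀ s : M, s * inv s * s = s)
    (hinv2 : ∀ s : M, inv s * s * inv s = inv s)
    (hcomm : ∀ e f : M, e * e = e → f * f = f → e * f = f * e)
    (le : M → M → Prop)
    (hle : ∀ u v : M, le u v ↔ ∃ e : M, e * e = e ∧ u = e * v)
    (s t u : M) (hu : le u (s * t)) :
    ∃! p : M × M,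
      le p.1 s ∧ le p.2 t ∧ inv p.1 * p.1 = p.2 * inv p.2 ∧ p.1 * p.2 = u := by
  obtain ⟨e, he, hu⟩ := (hle _ _).1 hu
  have idem_left (x : M) : (x * inv x) * (x * inv x) = x * inv x := by
    rw [← mul_assoc, hinv1]
  have idem_right (x : M) : (inv x * x) * (inv x * x) = inv x * x := by
    rw [← mul_assoc, hinv2]
  have inv_mul_rev := inv_mul_rev_of_idempotents_comm hinv1 hinv2 hcomm
  refine ⟨(u * inv u * s, inv (u * inv u * s) * (u * inv u * s) * t),
    ⟨(hle _ _).2 ⟨_, idem_left u, rfl⟩, (hle _ _).2 ⟨_, idem_right _, rfl⟩, ?_, ?_⟩, ?_⟩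
  · have ha := mul_inv_mul_mul_inv_of_eq_idempotent_mul hinv1 hinv2 hcomm he hu
    dsimp only
    generalize u * inv u * s = a at ha ⊢
    have hat : (inv a * a) * (t * inv t) = inv a * a := by rw [mul_assoc, ha]
    have hinva : inv (inv a * a) = inv a * a :=
      inverse_unique_of_idempotents_comm hcomm (hinv1 _) (hinv2 _)
        (by rw [idem_right, idem_right]) (by rw [idem_right, idem_right])
    rw [inv_mul_rev, hinva, mul_assoc (inv a * a) t, ← mul_assoc t, ← mul_assoc, hat,
      idem_right]
  · dsimp only
    rw [← mul_assoc, ← mul_assoc, hinv1, mul_assoc]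
    exact mul_inv_mul_eq_of_eq_idempotent_mul hinv1 hcomm he hu
  · rintro ⟨a, b⟩ ⟨has, hbt, hab, rfl⟩
    dsimp only at has hbt hab
    obtain ⟨f, hf, haf⟩ := (hle _ _).1 has
    obtain ⟨g, hg, hbg⟩ := (hle _ _).1 hbt
    have hdom : (a * b) * inv (a * b) = a * inv a := by
      rw [inv_mul_rev, mul_assoc a, ← mul_assoc b, ← hab, hinv2]
    have ha : (a * b) * inv (a * b) * s = a := by
      rw [hdom, mul_inv_mul_eq_of_eq_idempotent_mul hinv1 hcomm hf haf]
    rw [ha, hab, mul_inv_mul_eq_of_eq_idempotent_mul hinv1 hcomm hg hbg]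
end

section
/- Let M be a finite inverse monoid carrying a partial order (with decidable equality and locally finite order structure) whose order relation satisfies s ≤ t iff s = e*t for some idempotent e, and let A be a nontrivial commutative ring. In the monoid algebra A[M], define ⌊s⌋ = Σ_{t ≤ s} μ(t,s)·t, where μ is the Möbius function of the poset M with values in A. Then for all s, t ∈ M: ⌊s⌋ * ⌊t⌋ = ⌊s*t⌋ if inv s * s = t * inv t, and ⌊s⌋ * ⌊t⌋ = 0 otherwise. -/
open scoped Classical

/-- The "groupoid basis" element `⌊s⌋ = ∑_{t ≤ s} μ(t,s)·t` of the monoid algebra of a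
finite inverse monoid, where `μ` is the Möbius function of the natural partial order. -/
noncomputable def floorElt {M : Type*} [Monoid M] [Fintype M] [PartialOrder M]
    [LocallyFiniteOrder M] [DecidableEq M] (A : Type*) [CommRing A] (s : M) :
    MonoidAlgebra A M :=
  ∑ t ∈ Finset.univ.filter (· ≤ s), MonoidAlgebra.single t (IncidenceAlgebra.mu A t s)

theorem Finset.eq_of_forall_sum_le_eq {P B : Type*} [Fintype P] [PartialOrder P]
    [AddCommGroup B] {f g : P → B}
    (h : ∀ a, ∑ x ∈ Finset.univ.filter (· ≤ a), f x = ∑ x ∈ Finset.univ.filter (· ≤ a), g x)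
    (a : P) : f a = g a := by
  induction a using WellFoundedLT.induction with
  | ind a ih =>
    have ha : a ∈ Finset.univ.filter (· ≤ a) := by simp
    have hs := h a
    rw [← Finset.add_sum_erase _ _ ha, ← Finset.add_sum_erase _ _ ha,
      Finset.sum_congr rfl fun x hx => ih x ?_] at hs
    · exact add_right_cancel hs
    · simp only [Finset.mem_erase, Finset.mem_filter_univ] at hx
      exact lt_of_le_of_ne hx.2 hx.1

theorem sum_floorElt_le {M : Type*} [Monoid M] [Fintype M] [PartialOrder M]
    [LocallyFiniteOrder M] [DecidableEq M] (A : Type*) [CommRing A] (s : M) :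
    ∑ t ∈ Finset.univ.filter (· ≤ s), floorElt A t = MonoidAlgebra.single s 1 := by
  unfold floorElt
  rw [Finset.sum_comm' (t' := Finset.univ.filter (· ≤ s)) (s' := fun r => Finset.Icc r s)
    (by intro x y; simp only [Finset.mem_filter_univ, Finset.mem_Icc]
        exact ⟨fun h => ⟨⟨h.2, h.1⟩, h.2.trans h.1⟩, fun h => ⟨h.1.2, h.1.1⟩⟩)]
  have key (r : M) : ∑ t ∈ Finset.Icc r s, MonoidAlgebra.single r (IncidenceAlgebra.mu A r t) =
      if r = s then MonoidAlgebra.single s (1 : A) else 0 := by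
    refine (map_sum (MonoidAlgebra.singleAddHom r) _ _).symm.trans ?_
    rw [IncidenceAlgebra.sum_Icc_mu_right]
    split_ifs with hr <;> simp [hr]
  simp [key]

/-- `inv` makes the monoid `M` an inverse monoid. -/
structure IsInverseMonoidInv {M : Type*} [Monoid M] (inv : M → M) : Prop where
  mul_inv_mul (s : M) : s * inv s * s = s
  inv_mul_inv (s : M) : inv s * s * inv s = inv s
  comm (e f : M) : e * e = e → f * f = f → e * f = f * e

namespace IsInverseMonoidInv

variable {M : Type*} [Monoid M] {inv : M → M} (h : IsInverseMonoidInv inv)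
include h

theorem mul_inv_idem (s : M) : s * inv s * (s * inv s) = s * inv s := by
  rw [← mul_assoc, h.mul_inv_mul]

theorem inv_mul_idem (s : M) : inv s * s * (inv s * s) = inv s * s := by
  rw [← mul_assoc, h.inv_mul_inv]

theorem eq_inv {s x : M} (h1 : s * x * s = s) (h2 : x * s * x = x) : x = inv s := by
  have a : s * x * (s * x) = s * x := by rw [← mul_assoc, h1]
  have b : x * s * (x * s) = x * s := by rw [← mul_assoc, h2]
  have ca := h.comm _ _ a (h.mul_inv_idem s)
  have cb := h.comm _ _ b (h.inv_mul_idem s)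
  have e1 : s * x = s * inv s := by
    calc s * x = s * inv s * s * x := by rw [h.mul_inv_mul]
      _ = s * inv s * (s * x) := by simp only [mul_assoc]
      _ = s * x * (s * inv s) := ca.symm
      _ = s * x * s * inv s := by simp only [mul_assoc]
      _ = s * inv s := by rw [h1]
  have e2 : x * s = inv s * s := by
    calc x * s = x * (s * inv s * s) := by rw [h.mul_inv_mul]
      _ = x * s * (inv s * s) := by simp only [mul_assoc]
      _ = inv s * s * (x * s) := cb
      _ = inv s * (s * x * s) := by simp only [mul_assoc]
      _ = inv s * s := by rw [h1]
  rw [← h2, e2, mul_assoc, e1, ← mul_assoc, h.inv_mul_inv]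

theorem inv_of_idem {e : M} (he : e * e = e) : inv e = e :=
  (h.eq_inv (by rw [he, he]) (by rw [he, he])).symm

theorem inv_mul_rev (s t : M) : inv (s * t) = inv t * inv s := by
  have c := h.comm _ _ (h.inv_mul_idem s) (h.mul_inv_idem t)
  refine (h.eq_inv ?_ ?_).symm
  · calc s * t * (inv t * inv s) * (s * t) = s * (t * inv t * (inv s * s)) * t := by
          simp only [mul_assoc]
      _ = (s * inv s * s) * (t * inv t * t) := by rw [← c]; simp only [mul_assoc]
      _ = s * t := by rw [h.mul_inv_mul, h.mul_inv_mul]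
  · calc inv t * inv s * (s * t) * (inv t * inv s)
          = inv t * (inv s * s * (t * inv t)) * inv s := by simp only [mul_assoc]
      _ = (inv t * t * inv t) * (inv s * s * inv s) := by rw [c]; simp only [mul_assoc]
      _ = inv t * inv s := by rw [h.inv_mul_inv, h.inv_mul_inv]

theorem inv_inv (s : M) : inv (inv s) = s :=
  (h.eq_inv (h.inv_mul_inv s) (h.mul_inv_mul s)).symm

/-- Conjugating an idempotent yields an idempotent. -/
theorem conj_idem (s : M) {e : M} (he : e * e = e) :
    inv s * e * s * (inv s * e * s) = inv s * e * s := by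
  have c := h.comm _ _ he (h.mul_inv_idem s)
  calc inv s * e * s * (inv s * e * s) = inv s * (e * (s * inv s)) * e * s := by
        simp only [mul_assoc]
    _ = (inv s * s * inv s) * (e * e) * s := by rw [c]; simp only [mul_assoc]
    _ = inv s * e * s := by rw [he, h.inv_mul_inv]

/-- An idempotent moves past `s` from left to right. -/
theorem idem_mul (s : M) {e : M} (he : e * e = e) : e * s = s * (inv s * e * s) := by
  have c := h.comm _ _ he (h.mul_inv_idem s)
  calc e * s = e * (s * inv s * s) := by rw [h.mul_inv_mul]
    _ = e * (s * inv s) * s := by simp only [mul_assoc]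
    _ = s * (inv s * e * s) := by rw [c]; simp only [mul_assoc]

/-- An idempotent moves past `s` from right to left. -/
theorem mul_idem (s : M) {e : M} (he : e * e = e) : s * e = s * e * inv s * s := by
  have c := h.comm _ _ he (h.inv_mul_idem s)
  calc s * e = s * inv s * s * e := by rw [h.mul_inv_mul]
    _ = s * (inv s * s * e) := by simp only [mul_assoc]
    _ = s * e * inv s * s := by rw [← c]; simp only [mul_assoc]

section Order

variable [PartialOrder M] (horder : ∀ s t : M, s ≤ t ↔ ∃ e : M, e * e = e ∧ s = e * t)
include horder

theorem mul_le_of_idem (s : M) {e : M} (he : e * e = e) : s * e ≤ s := by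
  refine (horder _ _).2 ⟨s * e * inv s, ?_, h.mul_idem s he⟩
  simpa only [h.inv_inv] using h.conj_idem (inv s) he

theorem eq_mul_inv_mul_of_le {s t : M} (hst : s ≤ t) : s = s * inv s * t := by
  obtain ⟨e, he, rfl⟩ := (horder _ _).1 hst
  have c := h.comm _ _ he (h.mul_inv_idem t)
  rw [h.inv_mul_rev, h.inv_of_idem he]
  calc e * t = e * e * (t * inv t * t) := by rw [he, h.mul_inv_mul]
    _ = e * (e * (t * inv t)) * t := by simp only [mul_assoc]
    _ = e * t * (inv t * e) * t := by rw [c]; simp only [mul_assoc]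

theorem eq_mul_mul_inv_of_le {s t : M} (hst : s ≤ t) : s = t * (inv s * s) := by
  obtain ⟨e, he, rfl⟩ := (horder _ _).1 hst
  rw [h.inv_mul_rev, h.inv_of_idem he]
  calc e * t = t * (inv t * e * t) := h.idem_mul t he
    _ = t * (inv t * (e * e) * t) := by rw [he]
    _ = t * (inv t * e * (e * t)) := by simp only [mul_assoc]

theorem mul_le_mul {a b s t : M} (ha : a ≤ s) (hb : b ≤ t) : a * b ≤ s * t := by
  obtain ⟨e, he, rfl⟩ := (horder _ _).1 ha
  have hb' := h.eq_mul_mul_inv_of_le horder hb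
  rw [hb', show e * s * (t * (inv b * b)) = e * (s * t * (inv b * b)) by simp only [mul_assoc]]
  exact ((horder _ _).2 ⟨e, he, rfl⟩).trans (h.mul_le_of_idem horder _ (h.inv_mul_idem b))

/-- The factorization of `u ≤ s * t` through composable elements below `s` and `t`. -/
theorem composable_of_le_mul {u s t : M} (hu : u ≤ s * t) :
    inv (u * inv u * s) * (u * inv u * s) =
      t * (inv u * u) * inv (t * (inv u * u)) := by
  have iu := h.mul_inv_idem u
  have ui := h.inv_mul_idem u
  rw [h.inv_mul_rev _ s, h.inv_mul_rev t, h.inv_of_idem iu, h.inv_of_idem ui]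
  have l : inv s * (u * inv u) * (u * inv u * s) = inv s * (u * inv u) * s := by
    conv_rhs => rw [← iu]
    simp only [mul_assoc]
  have r : t * (inv u * u) * (inv u * u * inv t) = t * (inv u * u) * inv t := by
    conv_rhs => rw [← ui]
    simp only [mul_assoc]
  rw [l, r]
  obtain ⟨e, he, rfl⟩ := (horder _ _).1 hu
  rw [h.inv_mul_rev, h.inv_mul_rev, h.inv_of_idem he]
  have ci := h.conj_idem s he
  have ti := h.mul_inv_idem t
  have c := h.comm _ _ ci ti
  calc inv s * (e * (s * t) * (inv t * inv s * e)) * s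
        = inv s * e * s * (t * inv t) * (inv s * e * s) := by simp only [mul_assoc]
    _ = t * inv t * (inv s * e * s) := by rw [c, mul_assoc, ci]
    _ = t * inv t * (t * inv t) * (inv s * e * s) := by rw [ti]
    _ = t * inv t * (inv s * e * s * (t * inv t)) := by rw [c]; simp only [mul_assoc]
    _ = t * inv t * (inv s * (e * e) * s * (t * inv t)) := by rw [he]
    _ = t * (inv t * inv s * e * (e * (s * t))) * inv t := by simp only [mul_assoc]

/-- Elements below `s * t` are uniquely products of composable elements below `s` and `t`. -/
theorem sum_composable {B : Type*} [AddCommMonoid B] [Fintype M] (f : M → B) (s t : M) :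
    ∑ p ∈ Finset.univ.filter (· ≤ (s, t)),
      (if inv p.1 * p.1 = p.2 * inv p.2 then f (p.1 * p.2) else 0) =
    ∑ u ∈ Finset.univ.filter (· ≤ s * t), f u := by
  rw [← Finset.sum_filter]
  refine Finset.sum_bij' (fun p _ => p.1 * p.2)
    (fun u _ => (u * inv u * s, t * (inv u * u))) ?_ ?_ ?_ ?_ ?_
  · rintro ⟨a, b⟩ hp
    simp only [Finset.mem_filter, Finset.mem_univ, true_and, Prod.mk_le_mk] at hp ⊢
    exact h.mul_le_mul horder hp.1.1 hp.1.2
  · intro u hu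
    simp only [Finset.mem_filter, Finset.mem_univ, true_and, Prod.mk_le_mk] at hu ⊢
    exact ⟨⟨(horder _ _).2 ⟨_, h.mul_inv_idem u, rfl⟩,
      h.mul_le_of_idem horder _ (h.inv_mul_idem u)⟩, h.composable_of_le_mul horder hu⟩
  · rintro ⟨a, b⟩ hp
    simp only [Finset.mem_filter, Finset.mem_univ, true_and, Prod.mk_le_mk] at hp
    obtain ⟨⟨ha, hb⟩, hab⟩ := hp
    have e1 : a * b * inv (a * b) = a * inv a := by
      calc a * b * inv (a * b) = a * (b * inv b) * inv a := by
            rw [h.inv_mul_rev]; simp only [mul_assoc]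
        _ = a * inv a * a * inv a := by rw [← hab]; simp only [mul_assoc]
        _ = a * inv a := by rw [h.mul_inv_mul]
    have e2 : inv (a * b) * (a * b) = inv b * b := by
      calc inv (a * b) * (a * b) = inv b * (inv a * a) * b := by
            rw [h.inv_mul_rev]; simp only [mul_assoc]
        _ = inv b * b * inv b * b := by rw [hab]; simp only [mul_assoc]
        _ = inv b * b := by rw [h.inv_mul_inv]
    simp only [e1, e2, ← h.eq_mul_inv_mul_of_le horder ha, ← h.eq_mul_mul_inv_of_le horder hb]
  · intro u hu
    simp only [Finset.mem_filter, Finset.mem_univ, true_and] at hu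
    calc u * inv u * s * (t * (inv u * u)) = u * inv u * (s * t) * (inv u * u) := by
          simp only [mul_assoc]
      _ = u * inv u * u := by rw [← h.eq_mul_inv_mul_of_le horder hu, mul_assoc]
      _ = u := h.mul_inv_mul u
  · intros; rfl

end Order

end IsInverseMonoidInv

/-- In the monoid algebra of a finite inverse monoid, the groupoid basis elements multiply
according to the groupoid multiplication: `⌊s⌋ * ⌊t⌋ = ⌊s*t⌋` when the range idempotent of
`s` equals the domain idempotent of `t`, and `⌊s⌋ * ⌊t⌋ = 0` otherwise. -/
theorem floorElt_mul_floorElt {M : Type*} [Monoid M] [Fintype M] [DecidableEq M]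
    [PartialOrder M] [LocallyFiniteOrder M]
    (inv : M → M)
    (hinv1 : ∀ s : M, s * inv s * s = s)
    (hinv2 : ∀ s : M, inv s * s * inv s = inv s)
    (hcomm : ∀ e f : M, e * e = e → f * f = f → e * f = f * e)
    (horder : ∀ s t : M, s ≤ t ↔ ∃ e : M, e * e = e ∧ s = e * t)
    (A : Type*) [CommRing A] [Nontrivial A]
    (s t : M) :
    floorElt A s * floorElt A t =
      if inv s * s = t * inv t then floorElt A (s * t) else 0 := by
  have h : IsInverseMonoidInv inv := ⟨hinv1, hinv2, hcomm⟩
  refine Finset.eq_of_forall_sum_le_eq (P := M × M)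
    (f := fun p => floorElt A p.1 * floorElt A p.2)
    (g := fun p => if inv p.1 * p.1 = p.2 * inv p.2 then floorElt A (p.1 * p.2) else 0)
    ?_ (s, t)
  rintro ⟨s, t⟩
  trans ∑ u ∈ Finset.univ.filter (· ≤ s * t), floorElt A u
  · rw [sum_floorElt_le, ← mul_one (1 : A), ← MonoidAlgebra.single_mul_single,
      ← sum_floorElt_le, ← sum_floorElt_le, Finset.sum_mul_sum, ← Finset.sum_product']
    exact Finset.sum_congr (by ext; simp [Prod.le_def]) fun _ _ => rfl
  · rw [← h.sum_composable horder]
    refine Finset.sum_congr (by ext; simp) fun p _ => ?_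
    congr
end

section
/- Let M be a finite inverse monoid carrying a partial order (with decidable equality and locally finite order structure) whose order relation satisfies s ≤ t iff s = e*t for some idempotent e, and let A be a nontrivial commutative ring. In the monoid algebra A[M], define ⌊s⌋ = Σ_{t ≤ s} μ(t,s)·t, where μ is the Möbius function of the poset M with values in A. Then for all s, t ∈ M: ⌊s⌋ * t = ⌊s*t⌋ if inv s * s ≤ t * inv t, and ⌊s⌋ * t = 0 otherwise (here t denotes the basis element of A[M] corresponding to t). -/
open scoped Classical

theorem sum_floorElt_of_le {M : Type*} [Monoid M] [Fintype M] [PartialOrder M]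
    [LocallyFiniteOrder M] [DecidableEq M] (A : Type*) [CommRing A] (s : M) :
    ∑ u ∈ Finset.univ.filter (· ≤ s), floorElt A u = MonoidAlgebra.single s (1 : A) := by
  have h : ∀ t : M, ∑ u ∈ Finset.univ.filter (fun u => t ≤ u ∧ u ≤ s),
      MonoidAlgebra.single t (IncidenceAlgebra.mu A t u) =
        if t = s then MonoidAlgebra.single s (1 : A) else 0 := by
    intro t
    have hIcc : Finset.univ.filter (fun u => t ≤ u ∧ u ≤ s) = Finset.Icc t s := by
      ext u
      simp
    have hsum := map_sum (MonoidAlgebra.singleAddHom t)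
      (fun u => IncidenceAlgebra.mu A t u) (Finset.Icc t s)
    simp only [MonoidAlgebra.singleAddHom_apply] at hsum
    rw [hIcc, ← hsum, IncidenceAlgebra.sum_Icc_mu_right]
    split_ifs with hts
    · rw [hts]
    · exact MonoidAlgebra.single_zero _
  unfold floorElt
  rw [Finset.sum_comm' (t' := Finset.univ)
    (s' := fun t => Finset.univ.filter (fun u => t ≤ u ∧ u ≤ s)) (by intro x y; simp [and_comm]),
    Finset.sum_congr rfl fun t _ => h t]
  simp

/-- A function on a finite poset is determined by its sums over principal lower sets. -/
theorem eq_of_sum_filter_le_eq {P B : Type*} [Fintype P] [PartialOrder P] [AddCommGroup B]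
    (F G : P → B)
    (h : ∀ s, ∑ u ∈ Finset.univ.filter (· ≤ s), F u = ∑ u ∈ Finset.univ.filter (· ≤ s), G u)
    (s : P) : F s = G s := by
  induction s using WellFoundedLT.induction with
  | ind s ih =>
    have hs : s ∈ Finset.univ.filter (· ≤ s) := by simp
    have hsum := h s
    rw [← Finset.add_sum_erase _ _ hs, ← Finset.add_sum_erase _ G hs,
      Finset.sum_congr rfl fun u hu => ih u ?_] at hsum
    · exact add_right_cancel hsum
    · simp only [Finset.mem_erase, Finset.mem_filter, Finset.mem_univ, true_and] at hu
      exact lt_of_le_of_ne hu.2 hu.1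

section InverseMonoid

variable {M : Type*} [Monoid M] {inv : M → M}

theorem mul_mul_inv_eq_of_inv_mul_le [PartialOrder M]
    (hinv1 : ∀ s : M, s * inv s * s = s)
    (horder : ∀ s t : M, s ≤ t ↔ ∃ e : M, e * e = e ∧ s = e * t)
    {u t : M} (h : inv u * u ≤ t * inv t) : u * t * inv t = u := by
  obtain ⟨e, -, he⟩ := (horder _ _).1 h
  have hf : t * inv t * (t * inv t) = t * inv t := by rw [← mul_assoc, hinv1]
  calc u * t * inv t = u * (inv u * u) * (t * inv t) := by
        rw [← mul_assoc u (inv u), hinv1, mul_assoc]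
    _ = u * (inv u * u) := by rw [he, mul_assoc, mul_assoc, hf]
    _ = u := by rw [← mul_assoc, hinv1]

theorem mul_idempotent_le [PartialOrder M]
    (hinv1 : ∀ s : M, s * inv s * s = s)
    (hcomm : ∀ e f : M, e * e = e → f * f = f → e * f = f * e)
    (horder : ∀ s t : M, s ≤ t ↔ ∃ e : M, e * e = e ∧ s = e * t)
    (s : M) {f : M} (hf : f * f = f) : s * f ≤ s := by
  have hd : inv s * s * (inv s * s) = inv s * s := by rw [mul_assoc, ← mul_assoc s, hinv1]
  have hc := hcomm _ _ hf hd
  have hs : s * f * inv s * s = s * f := by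
    rw [mul_assoc, mul_assoc, hc, ← mul_assoc, ← mul_assoc, hinv1]
  refine (horder _ _).2 ⟨s * f * inv s, ?_, hs.symm⟩
  rw [← mul_assoc, ← mul_assoc, hs, mul_assoc s, hf]

theorem mul_inv_le_of_le_mul [PartialOrder M]
    (hinv1 : ∀ s : M, s * inv s * s = s)
    (hcomm : ∀ e f : M, e * e = e → f * f = f → e * f = f * e)
    (horder : ∀ s t : M, s ≤ t ↔ ∃ e : M, e * e = e ∧ s = e * t)
    {v s t : M} (h : v ≤ s * t) : v * inv t ≤ s := by
  obtain ⟨e, he, rfl⟩ := (horder _ _).1 h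
  have hf : t * inv t * (t * inv t) = t * inv t := by rw [← mul_assoc, hinv1]
  have hle : e * (s * (t * inv t)) ≤ s * (t * inv t) := (horder _ _).2 ⟨e, he, rfl⟩
  simpa only [mul_assoc] using hle.trans (mul_idempotent_le hinv1 hcomm horder s hf)

theorem mul_inv_mul_eq_of_le_mul [PartialOrder M]
    (hinv1 : ∀ s : M, s * inv s * s = s)
    (horder : ∀ s t : M, s ≤ t ↔ ∃ e : M, e * e = e ∧ s = e * t)
    {v s t : M} (h : v ≤ s * t) : v * inv t * t = v := by
  obtain ⟨e, -, rfl⟩ := (horder _ _).1 h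
  calc e * (s * t) * inv t * t = e * (s * (t * inv t * t)) := by simp only [mul_assoc]
    _ = e * (s * t) := by rw [hinv1]

theorem inv_mul_self_le_of_mul_inv [PartialOrder M]
    (hinv2 : ∀ s : M, inv s * s * inv s = inv s)
    (horder : ∀ s t : M, s ≤ t ↔ ∃ e : M, e * e = e ∧ s = e * t)
    (v t : M) : inv (v * inv t) * (v * inv t) ≤ t * inv t := by
  refine (horder _ _).2 ⟨inv (v * inv t) * (v * inv t), ?_, ?_⟩
  · rw [← mul_assoc, hinv2]
  · rw [mul_assoc, mul_assoc v, ← mul_assoc (inv t), hinv2]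

/-- Right multiplication by `t` is a bijection from the `u ≤ s` with `inv u * u ≤ t * inv t`
onto the lower set of `s * t`. -/
theorem sum_le_filter_inv_mul_le [Fintype M] [PartialOrder M] {B : Type*} [AddCommMonoid B]
    (hinv1 : ∀ s : M, s * inv s * s = s)
    (hinv2 : ∀ s : M, inv s * s * inv s = inv s)
    (hcomm : ∀ e f : M, e * e = e → f * f = f → e * f = f * e)
    (horder : ∀ s t : M, s ≤ t ↔ ∃ e : M, e * e = e ∧ s = e * t)
    (s t : M) (g : M → B) :
    ∑ u ∈ Finset.univ.filter (· ≤ s), (if inv u * u ≤ t * inv t then g (u * t) else 0) =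
      ∑ v ∈ Finset.univ.filter (· ≤ s * t), g v := by
  rw [← Finset.sum_filter]
  refine Finset.sum_nbij' (· * t) (· * inv t) ?_ ?_ ?_ ?_ fun _ _ => rfl <;>
    simp only [Finset.mem_filter, Finset.mem_univ, true_and]
  · rintro u ⟨hu, -⟩
    obtain ⟨e, he, rfl⟩ := (horder _ _).1 hu
    exact (horder _ _).2 ⟨e, he, mul_assoc _ _ _⟩
  · exact fun v hv => ⟨mul_inv_le_of_le_mul hinv1 hcomm horder hv,
      inv_mul_self_le_of_mul_inv hinv2 horder v t⟩
  · exact fun u hu => mul_mul_inv_eq_of_inv_mul_le hinv1 horder hu.2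
  · exact fun v hv => mul_inv_mul_eq_of_le_mul hinv1 horder hv

end InverseMonoid

/-- In the monoid algebra of a finite inverse monoid, multiplying a groupoid basis element
by an ordinary basis element gives `⌊s⌋ * t = ⌊s*t⌋` when `inv s * s ≤ t * inv t`, and
`⌊s⌋ * t = 0` otherwise. -/
theorem floorElt_mul_single {M : Type*} [Monoid M] [Fintype M] [DecidableEq M]
    [PartialOrder M] [LocallyFiniteOrder M]
    (inv : M → M)
    (hinv1 : ∀ s : M, s * inv s * s = s)
    (hinv2 : ∀ s : M, inv s * s * inv s = inv s)
    (hcomm : ∀ e f : M, e * e = e → f * f = f → e * f = f * e)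
    (horder : ∀ s t : M, s ≤ t ↔ ∃ e : M, e * e = e ∧ s = e * t)
    (A : Type*) [CommRing A] [Nontrivial A]
    (s t : M) :
    floorElt A s * MonoidAlgebra.single t (1 : A) =
      if inv s * s ≤ t * inv t then floorElt A (s * t) else 0 := by
  refine eq_of_sum_filter_le_eq (fun s => floorElt A s * MonoidAlgebra.single t (1 : A))
    (fun s => if inv s * s ≤ t * inv t then floorElt A (s * t) else 0) (fun s => ?_) s
  rw [← Finset.sum_mul, sum_floorElt_of_le, MonoidAlgebra.single_mul_single, mul_one,
    sum_le_filter_inv_mul_le hinv1 hinv2 hcomm horder, sum_floorElt_of_le]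
end

section
/- Let M be a finite inverse monoid and K a field of characteristic zero. Then the monoid algebra MonoidAlgebra K M is a semisimple ring. -/
namespace InverseMonoid

variable {M : Type*} [Monoid M] {inv : M → M}

theorem isIdempotentElem_inv_mul (hinv1 : ∀ s : M, s * inv s * s = s) (s : M) :
    inv s * s * (inv s * s) = inv s * s := by
  rw [mul_assoc, ← mul_assoc s, hinv1]

theorem isIdempotentElem_mul_inv (hinv1 : ∀ s : M, s * inv s * s = s) (s : M) :
    s * inv s * (s * inv s) = s * inv s := by
  rw [← mul_assoc, hinv1]

/-- Generalized inverses are unique as soon as idempotents commute. -/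
theorem eq_of_isInverse (hcomm : ∀ e f : M, e * e = e → f * f = f → e * f = f * e)
    {s a b : M} (ha : s * a * s = s) (ha' : a * s * a = a) (hb : s * b * s = s)
    (hb' : b * s * b = b) : a = b := by
  have h1 : s * a * (s * b) = s * b * (s * a) :=
    hcomm _ _ (by rw [← mul_assoc, ha]) (by rw [← mul_assoc, hb])
  have h2 : b * s * (a * s) = a * s * (b * s) :=
    hcomm _ _ (by rw [← mul_assoc, hb']) (by rw [← mul_assoc, ha'])
  calc a = a * (s * b * s) * a := by rw [hb, ha']
    _ = a * (s * b * (s * a)) := by simp only [mul_assoc]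
    _ = a * s * a * (s * b) := by rw [← h1]; simp only [mul_assoc]
    _ = a * s * (b * s * b) := by rw [ha', hb', mul_assoc]
    _ = a * s * (b * s) * b := by simp only [mul_assoc]
    _ = b * (s * a * s) * b := by rw [← h2]; simp only [mul_assoc]
    _ = b := by rw [ha, hb']

theorem inv_inv_eq (hinv1 : ∀ s : M, s * inv s * s = s)
    (hinv2 : ∀ s : M, inv s * s * inv s = inv s)
    (hcomm : ∀ e f : M, e * e = e → f * f = f → e * f = f * e) (s : M) :
    inv (inv s) = s :=
  eq_of_isInverse hcomm (hinv1 (inv s)) (hinv2 (inv s)) (hinv2 s) (hinv1 s)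

theorem inv_mul_eq (hinv1 : ∀ s : M, s * inv s * s = s)
    (hinv2 : ∀ s : M, inv s * s * inv s = inv s)
    (hcomm : ∀ e f : M, e * e = e → f * f = f → e * f = f * e) (s t : M) :
    inv (s * t) = inv t * inv s := by
  have h : t * inv t * (inv s * s) = inv s * s * (t * inv t) :=
    hcomm _ _ (isIdempotentElem_mul_inv hinv1 t) (isIdempotentElem_inv_mul hinv1 s)
  refine eq_of_isInverse hcomm (hinv1 _) (hinv2 _) ?_ ?_
  · calc s * t * (inv t * inv s) * (s * t)
        = s * (t * inv t * (inv s * s)) * t := by simp only [mul_assoc]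
      _ = s * inv s * s * (t * inv t * t) := by rw [h]; simp only [mul_assoc]
      _ = s * t := by rw [hinv1, hinv1]
  · calc inv t * inv s * (s * t) * (inv t * inv s)
        = inv t * (inv s * s * (t * inv t)) * inv s := by simp only [mul_assoc]
      _ = inv t * t * inv t * (inv s * s * inv s) := by rw [← h]; simp only [mul_assoc]
      _ = inv t * inv s := by rw [hinv2, hinv2]

/-- The graph of the partial bijection by which `s` acts on `M` on the left. -/
def Moves (inv : M → M) (s u v : M) : Prop := s * u = v ∧ inv s * v = u

theorem moves_one_iff (hinv1 : ∀ s : M, s * inv s * s = s) {u v : M} :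
    Moves inv 1 u v ↔ u = v := by
  have h : inv 1 = 1 := by simpa using hinv1 1
  simp only [Moves, h, one_mul, and_iff_left_iff_imp]
  exact Eq.symm

theorem moves_inv_iff (hinv1 : ∀ s : M, s * inv s * s = s)
    (hinv2 : ∀ s : M, inv s * s * inv s = inv s)
    (hcomm : ∀ e f : M, e * e = e → f * f = f → e * f = f * e) {s u v : M} :
    Moves inv (inv s) u v ↔ Moves inv s v u := by
  rw [Moves, inv_inv_eq hinv1 hinv2 hcomm, and_comm, Moves]

theorem moves_mul_iff (hinv1 : ∀ s : M, s * inv s * s = s)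
    (hinv2 : ∀ s : M, inv s * s * inv s = inv s)
    (hcomm : ∀ e f : M, e * e = e → f * f = f → e * f = f * e) {s t u w : M} :
    Moves inv (s * t) u w ↔ Moves inv t u (t * u) ∧ Moves inv s (t * u) w := by
  unfold Moves
  rw [inv_mul_eq hinv1 hinv2 hcomm]
  constructor
  · rintro ⟨hw, hu⟩
    have h : t * inv t * (inv s * s) = inv s * s * (t * inv t) :=
      hcomm _ _ (isIdempotentElem_mul_inv hinv1 t) (isIdempotentElem_inv_mul hinv1 s)
    refine ⟨⟨rfl, ?_⟩, by rw [← mul_assoc, hw], ?_⟩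
    · calc inv t * (t * u) = inv t * t * inv t * (inv s * w) := by
            conv_lhs => rw [← hu]
            simp only [mul_assoc]
        _ = u := by rw [hinv2, ← mul_assoc, hu]
    · calc inv s * w = inv s * s * (t * inv t * t) * u := by
            rw [hinv1, ← hw]; simp only [mul_assoc]
        _ = inv s * s * (t * inv t) * (t * u) := by simp only [mul_assoc]
        _ = t * (inv t * inv s * (s * t * u)) := by rw [← h]; simp only [mul_assoc]
        _ = t * u := by rw [hw, hu]
  · rintro ⟨⟨-, h1⟩, h2, h3⟩
    exact ⟨by rw [mul_assoc, h2], by rw [mul_assoc, h3, h1]⟩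

open Classical in
/-- The matrix whose column at `s` lists the entries of the matrix of the partial bijection
given by `s`. -/
noncomputable def movesMatrix (R : Type*) [Zero R] [One R] (inv : M → M) :
    Matrix (M × M) M R :=
  Matrix.of fun p s => if Moves inv s p.2 p.1 then 1 else 0

open Classical in
/-- The representation of an inverse monoid by partial bijections of itself. -/
noncomputable def partialBijectionRep [Fintype M] (R : Type*) [Semiring R]
    (hinv1 : ∀ s : M, s * inv s * s = s)
    (hinv2 : ∀ s : M, inv s * s * inv s = inv s)
    (hcomm : ∀ e f : M, e * e = e → f * f = f → e * f = f * e) :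
    M →* Matrix M M R where
  toFun s := Matrix.of fun v u => movesMatrix R inv (v, u) s
  map_one' := by
    ext v u
    simp [movesMatrix, moves_one_iff hinv1, Matrix.one_apply, eq_comm]
  map_mul' s t := by
    ext w u
    rw [Matrix.mul_apply, Finset.sum_eq_single (t * u)]
    · simp [movesMatrix, moves_mul_iff hinv1 hinv2 hcomm, ← ite_and, and_comm]
    · intro v _ hv
      have : ¬ Moves inv t u v := fun h => hv h.1.symm
      simp [movesMatrix, this]
    · simp

/-- The partial bijections given by the elements of an inverse monoid are linearly
independent. -/
theorem eq_zero_of_movesMatrix_mulVec_eq_zero [Fintype M] {R : Type*} [Semiring R]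
    (hinv1 : ∀ s : M, s * inv s * s = s)
    (hcomm : ∀ e f : M, e * e = e → f * f = f → e * f = f * e)
    {a : M → R} (h : (movesMatrix R inv).mulVec a = 0) : a = 0 := by
  classical
  by_contra hne
  obtain ⟨s₁, hs₁⟩ := Function.ne_iff.mp hne
  -- a support element with the largest domain is not a proper restriction of another one
  obtain ⟨s₀, hs₀, hmax⟩ := Finset.exists_max_image {s | a s ≠ 0}
    (fun s => Finset.card {m | inv s * s * m = m}) ⟨s₁, by simpa using hs₁⟩
  simp only [Finset.mem_filter, Finset.mem_univ, true_and] at hs₀ hmax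
  refine hs₀ ?_
  have key := congrFun h (s₀, inv s₀ * s₀)
  rw [Matrix.mulVec, dotProduct, Finset.sum_eq_single s₀] at key
  · simpa [movesMatrix, Moves, ← mul_assoc, hinv1] using key
  · intro s _ hs
    by_cases has : a s = 0
    · simp [has]
    suffices ¬ Moves inv s (inv s₀ * s₀) s₀ by simp [movesMatrix, this]
    rintro ⟨h1, h2⟩
    have hle : inv s * s * (inv s₀ * s₀) = inv s₀ * s₀ := by rw [mul_assoc, h1, h2]
    have hsub : ({m | inv s₀ * s₀ * m = m} : Finset M) ⊆
        ({m | inv s * s * m = m} : Finset M) := by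
      intro m hm
      simp only [Finset.mem_filter, Finset.mem_univ, true_and] at hm ⊢
      rw [← hm, ← mul_assoc, hle]
    have hmem : inv s * s ∈ ({m | inv s₀ * s₀ * m = m} : Finset M) := by
      rw [Finset.eq_of_subset_of_card_le hsub (hmax s has)]
      simpa using isIdempotentElem_inv_mul hinv1 s
    have heq : inv s₀ * s₀ = inv s * s := by
      rw [← hle, hcomm _ _ (isIdempotentElem_inv_mul hinv1 s)
        (isIdempotentElem_inv_mul hinv1 s₀)]
      simpa using hmem
    exact hs (by rw [← h1, heq, ← mul_assoc, hinv1])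
  · simp

theorem trace_partialBijectionRep_inv_mul [Fintype M] {R : Type*} [Semiring R]
    (hinv1 : ∀ s : M, s * inv s * s = s)
    (hinv2 : ∀ s : M, inv s * s * inv s = inv s)
    (hcomm : ∀ e f : M, e * e = e → f * f = f → e * f = f * e) (s t : M) :
    (partialBijectionRep R hinv1 hinv2 hcomm (inv t) *
      partialBijectionRep R hinv1 hinv2 hcomm s).trace =
    ((movesMatrix R inv).transpose * movesMatrix R inv) t s := by
  classical
  simp only [Matrix.trace, Matrix.diag_apply, Matrix.mul_apply, Fintype.sum_prod_type_right,
    partialBijectionRep, movesMatrix, MonoidHom.coe_mk, OneHom.coe_mk, Matrix.of_apply,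
    Matrix.transpose_apply]
  refine Finset.sum_congr rfl fun u _ => Finset.sum_congr rfl fun v _ => ?_
  congr 1
  exact if_congr (moves_inv_iff hinv1 hinv2 hcomm) rfl rfl

/-- The Gram matrix of the partial bijections is nonsingular in characteristic zero. -/
theorem det_gram_movesMatrix_ne_zero [Fintype M] [DecidableEq M] (K : Type*) [Field K]
    [CharZero K] (hinv1 : ∀ s : M, s * inv s * s = s)
    (hcomm : ∀ e f : M, e * e = e → f * f = f → e * f = f * e) :
    ((movesMatrix K inv).transpose * movesMatrix K inv).det ≠ 0 := by
  have hZ : ((movesMatrix ℤ inv).transpose * movesMatrix ℤ inv).det ≠ 0 := by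
    intro hdet
    obtain ⟨a, ha, ha0⟩ := Matrix.exists_mulVec_eq_zero_iff.mpr hdet
    rw [← Matrix.conjTranspose_eq_transpose_of_trivial,
      Matrix.conjTranspose_mul_self_mulVec_eq_zero] at ha0
    exact ha (eq_zero_of_movesMatrix_mulVec_eq_zero hinv1 hcomm ha0)
  have hmap : movesMatrix K inv = (movesMatrix ℤ inv).map (Int.castRingHom K) := by
    ext p s
    simp [movesMatrix]
  rw [hmap, ← Matrix.transpose_map, ← Matrix.map_mul, ← RingHom.mapMatrix_apply,
    ← RingHom.map_det]
  simpa using hZ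

end InverseMonoid

open InverseMonoid in
/-- The monoid algebra of a finite inverse monoid over a field of characteristic zero is
semisimple. -/
theorem monoidAlgebra_isSemisimpleRing_of_charZero {M : Type*} [Monoid M] [Fintype M]
    (inv : M → M)
    (hinv1 : ∀ s : M, s * inv s * s = s)
    (hinv2 : ∀ s : M, inv s * s * inv s = inv s)
    (hcomm : ∀ e f : M, e * e = e → f * f = f → e * f = f * e)
    (K : Type*) [Field K] [CharZero K] :
    IsSemisimpleRing (MonoidAlgebra K M) := by
  classical
  have : IsArtinianRing (MonoidAlgebra K M) := IsArtinianRing.of_finite K _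
  rw [IsArtinianRing.isSemisimpleRing_iff_jacobson, eq_bot_iff]
  intro x hx
  let ρ := MonoidAlgebra.lift K (Matrix M M K) M (partialBijectionRep K hinv1 hinv2 hcomm)
  have htrace (t : M) : (ρ (MonoidAlgebra.of K M (inv t) * x)).trace = 0 := by
    obtain ⟨n, hn⟩ := IsSemiprimaryRing.isNilpotent (R := MonoidAlgebra K M)
    have hnil : IsNilpotent (MonoidAlgebra.of K M (inv t) * x) :=
      ⟨n, by simpa [hn] using Ideal.pow_mem_pow (Ideal.mul_mem_left _ (.of K M (inv t)) hx) n⟩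
    exact (Matrix.isNilpotent_trace_of_isNilpotent (hnil.map ρ)).eq_zero
  have hgram : ((movesMatrix K inv).transpose * movesMatrix K inv).mulVec x.coeff = 0 := by
    ext t
    rw [Pi.zero_apply, ← htrace t, map_mul, MonoidAlgebra.lift_of, MonoidAlgebra.lift_apply,
      Finsupp.sum_fintype _ _ (by simp), Finset.mul_sum, Matrix.trace_sum, Matrix.mulVec,
      dotProduct]
    refine Finset.sum_congr rfl fun s _ => ?_
    rw [mul_smul_comm, Matrix.trace_smul, trace_partialBijectionRep_inv_mul, smul_eq_mul,
      mul_comm]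
  have hx0 := Matrix.eq_zero_of_mulVec_eq_zero
    (det_gram_movesMatrix_ne_zero K hinv1 hcomm) hgram
  exact MonoidAlgebra.coeff_eq_zero.mp (DFunLike.coe_injective hx0)
end

section
/- Let M be a finite inverse monoid and K a field of prime characteristic p. Then the monoid algebra MonoidAlgebra K M is a semisimple ring if and only if for every idempotent e of M, p does not divide the cardinality of the maximal subgroup G_e = {s ∈ M | s * inv s = e and inv s * s = e}. -/
/-- `IsInverseMap inv` says that `inv` sends every element of a monoid with commuting idempotents
to a generalized inverse of it, so that the monoid is an inverse monoid. -/
structure IsInverseMap {M : Type*} [Monoid M] (inv : M → M) : Prop where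
  mul_inv_mul : ∀ s : M, s * inv s * s = s
  inv_mul_inv : ∀ s : M, inv s * s * inv s = inv s
  comm : ∀ e f : M, e * e = e → f * f = f → e * f = f * e

namespace IsInverseMap

variable {M : Type*} [Monoid M] {inv : M → M}

theorem mul_inv_idem (h : IsInverseMap inv) (s : M) :
    s * inv s * (s * inv s) = s * inv s := by
  rw [← mul_assoc, h.mul_inv_mul]

theorem inv_mul_idem (h : IsInverseMap inv) (s : M) :
    inv s * s * (inv s * s) = inv s * s := by
  rw [← mul_assoc, h.inv_mul_inv]

theorem eq_inv (h : IsInverseMap inv) {s t : M} (hst : s * t * s = s) (hts : t * s * t = t) :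
    t = inv s := by
  have h1 : t * s * (t * s) = t * s := by rw [← mul_assoc, hts]
  have h2 : s * t * (s * t) = s * t := by rw [← mul_assoc, hst]
  have c1 := h.comm _ _ h1 (h.inv_mul_idem s)
  have c2 := h.comm _ _ h2 (h.mul_inv_idem s)
  calc t = t * s * t := hts.symm
    _ = t * (s * inv s * s) * t := by rw [h.mul_inv_mul]
    _ = t * (s * inv s * (s * t)) := by simp only [mul_assoc]
    _ = t * s * t * s * inv s := by rw [← c2]; simp only [mul_assoc]
    _ = t * (s * inv s * s) * inv s := by rw [hts, h.mul_inv_mul]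
    _ = t * s * (inv s * s) * inv s := by simp only [mul_assoc]
    _ = inv s * (s * t * s) * inv s := by rw [c1]; simp only [mul_assoc]
    _ = inv s := by rw [hst, h.inv_mul_inv]

theorem inv_inv (h : IsInverseMap inv) (s : M) : inv (inv s) = s :=
  (h.eq_inv (h.inv_mul_inv s) (h.mul_inv_mul s)).symm

theorem inv_mul (h : IsInverseMap inv) (s t : M) : inv (s * t) = inv t * inv s := by
  have c := h.comm _ _ (h.mul_inv_idem t) (h.inv_mul_idem s)
  refine (h.eq_inv ?_ ?_).symm
  · calc s * t * (inv t * inv s) * (s * t) = s * (t * inv t * (inv s * s)) * t := by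
          simp only [mul_assoc]
      _ = s * inv s * s * (t * inv t * t) := by rw [c]; simp only [mul_assoc]
      _ = s * t := by rw [h.mul_inv_mul, h.mul_inv_mul]
  · calc inv t * inv s * (s * t) * (inv t * inv s) = inv t * (inv s * s * (t * inv t)) * inv s := by
          simp only [mul_assoc]
      _ = inv t * t * inv t * (inv s * s * inv s) := by rw [← c]; simp only [mul_assoc]
      _ = inv t * inv s := by rw [h.inv_mul_inv, h.inv_mul_inv]

theorem inv_idem (h : IsInverseMap inv) {e : M} (he : e * e = e) : inv e = e :=
  (h.eq_inv (by rw [he, he]) (by rw [he, he])).symm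

theorem inv_mul_eq_of_mul_eq (h : IsInverseMap inv) {s u : M} (hsu : s * u = u) :
    inv s * u = u := by
  have h1 : inv u * inv s = inv u := by rw [← h.inv_mul, hsu]
  have h2 : u * inv u * (inv s * s) * (u * inv u) = u * inv u := by
    calc u * inv u * (inv s * s) * (u * inv u) = u * (inv u * inv s) * (s * u) * inv u := by
          simp only [mul_assoc]
      _ = u * inv u := by rw [h1, hsu, h.mul_inv_mul]
  rw [h.comm _ _ (h.mul_inv_idem u) (h.inv_mul_idem s), mul_assoc, h.mul_inv_idem] at h2
  calc inv s * u = inv s * s * (u * inv u) * u := by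
        rw [mul_assoc _ _ u, h.mul_inv_mul, mul_assoc, hsu]
    _ = u := by rw [h2, h.mul_inv_mul]

/-- If `t` is below `s` in the natural partial order, it is a restriction of `s` on both sides. -/
theorem mul_inv_mul_of_mul_inv_eq (h : IsInverseMap inv) {s t : M}
    (hst : s * inv t = t * inv t) : t * inv t * s = t := by
  have h1 : t * inv s = t * inv t := by
    have := congrArg inv hst
    rwa [h.inv_mul, h.inv_mul, h.inv_inv] at this
  calc t * inv t * s = t * inv t * t * (inv s * s) := by
        rw [h.mul_inv_mul, ← h1, mul_assoc]
    _ = s * (inv t * t * (inv s * s)) := by rw [← hst]; simp only [mul_assoc]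
    _ = s * inv s * s * (inv t * t) := by
        rw [h.comm _ _ (h.inv_mul_idem t) (h.inv_mul_idem s)]; simp only [mul_assoc]
    _ = s * inv t * t := by rw [h.mul_inv_mul]; simp only [mul_assoc]
    _ = t := by rw [hst, h.mul_inv_mul]

/-- Stability of finite inverse monoids. -/
theorem mul_inv_eq_of_inv_mul_eq [Finite M] (h : IsInverseMap inv) {x u : M}
    (hx : x * u = u) (hu : inv u * u = x) : u * inv u = x := by
  have hxx : x * x = x := hu ▸ h.inv_mul_idem u
  let f : {v : M // x * v = v} → {v : M // x * v = v} :=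
    fun v ↦ ⟨u * v, by rw [← mul_assoc, hx]⟩
  have hf : Function.Injective f := by
    intro v w hvw
    have hvw : u * v.1 = u * w.1 := congrArg Subtype.val hvw
    ext
    calc v.1 = inv u * (u * v.1) := by rw [← mul_assoc, hu, v.2]
      _ = w.1 := by rw [hvw, ← mul_assoc, hu, w.2]
  obtain ⟨v, hv⟩ := Finite.surjective_of_injective hf ⟨x, hxx⟩
  have hv : u * v.1 = x := congrArg Subtype.val hv
  have h1 : u * inv u * x = x := by rw [← hv, ← mul_assoc, h.mul_inv_mul]
  rw [← h1, h.comm _ _ (h.mul_inv_idem u) hxx, ← mul_assoc, hx]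

section Finite

variable [Fintype M]

open scoped Classical in
/-- The maximal subgroup at `e`, as a finset. -/
noncomputable def maximalSubgroup (inv : M → M) (e : M) : Finset M :=
  {s | s * inv s = e ∧ inv s * s = e}

theorem mem_maximalSubgroup {e s : M} :
    s ∈ maximalSubgroup inv e ↔ s * inv s = e ∧ inv s * s = e := by
  simp [maximalSubgroup]

theorem card_maximalSubgroup (e : M) :
    Nat.card {s : M // s * inv s = e ∧ inv s * s = e} = (maximalSubgroup inv e).card :=
  Nat.subtype_card _ fun _ ↦ mem_maximalSubgroup

theorem mul_mem_maximalSubgroup (h : IsInverseMap inv) {e s t : M}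
    (hs : s ∈ maximalSubgroup inv e) (ht : t ∈ maximalSubgroup inv e) :
    s * t ∈ maximalSubgroup inv e := by
  rw [mem_maximalSubgroup] at *
  rw [h.inv_mul]
  constructor
  · rw [mul_assoc, ← mul_assoc t, ht.1, ← hs.2, h.inv_mul_inv, hs.1, hs.2]
  · rw [mul_assoc, ← mul_assoc (inv s), hs.2, ← ht.1, h.mul_inv_mul, ht.2, ht.1]

theorem inv_mem_maximalSubgroup (h : IsInverseMap inv) {e s : M}
    (hs : s ∈ maximalSubgroup inv e) : inv s ∈ maximalSubgroup inv e := by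
  rw [mem_maximalSubgroup] at *
  rw [h.inv_inv]
  exact hs.symm

theorem idem_mem_maximalSubgroup (h : IsInverseMap inv) {e : M} (he : e * e = e) :
    e ∈ maximalSubgroup inv e := by
  rw [mem_maximalSubgroup, h.inv_idem he]
  exact ⟨he, he⟩

theorem mul_idem_of_mem_maximalSubgroup (h : IsInverseMap inv) {e s : M}
    (hs : s ∈ maximalSubgroup inv e) : s * e = s := by
  rw [← (mem_maximalSubgroup.1 hs).2, ← mul_assoc, h.mul_inv_mul]

theorem idem_mul_of_mem_maximalSubgroup (h : IsInverseMap inv) {e s : M}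
    (hs : s ∈ maximalSubgroup inv e) : e * s = s := by
  rw [← (mem_maximalSubgroup.1 hs).1, h.mul_inv_mul]

open scoped Classical in
theorem card_fixed_eq_sum (h : IsInverseMap inv) {x : M} (hx : x * x = x) (s : M) :
    Finset.card {u : M | s * u * x = u} =
      ∑ z : M with z * x = z, Finset.card {u : M | inv u * u = z ∧ s * u = u} := by
  have key : ∀ u, s * u * x = u → u * x = u := fun u hu ↦ by
    rw [← hu, mul_assoc _ x, hx]
  rw [Finset.card_eq_sum_card_fiberwise (f := fun u ↦ inv u * u)
    (t := ({z : M | z * x = z} : Finset M))]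
  · refine Finset.sum_congr rfl fun z hz ↦ ?_
    congr 1
    ext u
    simp only [Finset.mem_filter, Finset.mem_univ, true_and] at hz ⊢
    rw [and_comm]
    refine and_congr_right fun hu ↦ ?_
    have hux : u * x = u := by rw [← h.mul_inv_mul u, mul_assoc u, hu, mul_assoc, hz]
    rw [mul_assoc, hux]
  · intro u hu
    simp only [Finset.coe_filter, Finset.mem_univ, true_and, Set.mem_ofPred_eq] at hu ⊢
    rw [mul_assoc, key u hu]

open scoped Classical in
theorem card_fixed_eq_ite (h : IsInverseMap inv) (s t : M) :
    Finset.card {u : M | inv u * u = t * inv t ∧ s * inv t * u = u} =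
      if s * inv t = t * inv t then (maximalSubgroup inv (t * inv t)).card else 0 := by
  have hcx : inv t * (t * inv t) = inv t := by rw [← mul_assoc, h.inv_mul_inv]
  have key : ∀ u, inv u * u = t * inv t → s * inv t * u = u →
      u * inv u = t * inv t ∧ s * inv t = t * inv t := by
    intro u hu hsu
    have hxu : t * inv t * u = u := by
      have hv : t * inv s * u = u := by
        have := h.inv_mul_eq_of_mul_eq hsu
        rwa [h.inv_mul, h.inv_inv] at this
      calc t * inv t * u = t * inv t * t * (inv s * u) := by
            nth_rw 1 [← hv]
            simp only [mul_assoc]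
        _ = u := by rw [h.mul_inv_mul, ← mul_assoc, hv]
    have hu' := h.mul_inv_eq_of_inv_mul_eq hxu hu
    refine ⟨hu', ?_⟩
    calc s * inv t = s * inv t * u * inv u := by
          rw [mul_assoc (s * inv t), hu', mul_assoc, hcx]
      _ = t * inv t := by rw [hsu, hu']
  split_ifs with hst
  · congr 1
    ext u
    simp only [Finset.mem_filter, Finset.mem_univ, true_and, mem_maximalSubgroup]
    refine ⟨fun hu ↦ ⟨(key u hu.1 hu.2).1, hu.1⟩, fun hu ↦ ⟨hu.2, ?_⟩⟩
    rw [hst, ← hu.1, h.mul_inv_mul]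
  · rw [Finset.card_eq_zero, Finset.filter_eq_empty_iff]
    exact fun u _ hu ↦ hst (key u hu.1 hu.2).2

end Finite

end IsInverseMap

namespace MonoidAlgebra

variable {M K : Type*} [Monoid M] [Fintype M] [Field K]

open scoped Classical in
theorem trace_mulLeft_mul_mulRight_single (a : MonoidAlgebra K M) (c x : M) :
    LinearMap.trace K (MonoidAlgebra K M)
        (LinearMap.mulLeft K (a * single c 1) * LinearMap.mulRight K (single x 1)) =
      ∑ s : M, a.coeff s * (Finset.card {u : M | s * c * u * x = u} : K) := by
  rw [LinearMap.trace_eq_matrix_trace K (MonoidAlgebra.basis M K), Matrix.trace]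
  simp only [Matrix.diag_apply, LinearMap.toMatrix_apply, Module.End.mul_apply, basis_apply,
    LinearMap.mulLeft_apply, LinearMap.mulRight_apply, Finset.natCast_card_filter]
  induction a using induction_linear with
  | zero => simp
  | add a b ha hb => simp only [add_mul, map_add, Finsupp.add_apply, Finset.sum_add_distrib, ha, hb,
      coeff_add]
  | single s r =>
    have hrepr : ∀ y : MonoidAlgebra K M, ⇑((MonoidAlgebra.basis M K).repr y) = ⇑y.coeff :=
      fun _ ↦ rfl
    simp [hrepr, Finsupp.single_apply, mul_assoc, ← Finset.sum_filter, mul_comm]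

open scoped Classical in
theorem sum_coeff_mul_card_fixed_eq_zero {a : MonoidAlgebra K M} {c x : M}
    (ha : IsNilpotent (a * single c 1)) :
    ∑ s : M, a.coeff s * (Finset.card {u : M | s * c * u * x = u} : K) = 0 := by
  rw [← trace_mulLeft_mul_mulRight_single]
  refine (LinearMap.isNilpotent_trace_of_isNilpotent ?_).eq_zero
  refine Commute.isNilpotent_mul_right ?_ ?_
  · ext; simp [mul_assoc]
  · exact (LinearMap.isNilpotent_mulLeft_iff K _).2 ha

open scoped Classical in
theorem sum_coeff_mul_card_inv_mul_eq_zero {inv : M → M} (h : IsInverseMap inv)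
    {a : MonoidAlgebra K M} {c : M} (ha : IsNilpotent (a * single c 1)) (x : M) (hx : x * x = x) :
    ∑ s : M, a.coeff s * (Finset.card {u : M | inv u * u = x ∧ s * c * u = u} : K) = 0 := by
  induction hn : Finset.card {w : M | w * x = w} using Nat.strong_induction_on generalizing x with
  | _ n ih =>
    have h0 := sum_coeff_mul_card_fixed_eq_zero (x := x) ha
    simp only [h.card_fixed_eq_sum hx, Nat.cast_sum, Finset.mul_sum] at h0
    rw [Finset.sum_comm, Finset.sum_eq_single x] at h0
    · exact h0
    · intro z hz hzx
      simp only [Finset.mem_filter, Finset.mem_univ, true_and] at hz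
      by_cases hzz : z * z = z
      · refine ih _ ?_ z hzz rfl
        rw [← hn]
        refine Finset.card_lt_card ((Finset.ssubset_iff_of_subset fun w hw ↦ ?_).2 ⟨x, ?_, ?_⟩)
        · simp only [Finset.mem_filter, Finset.mem_univ, true_and] at hw ⊢
          rw [← hw, mul_assoc, hz]
        · simpa using hx
        · simp only [Finset.mem_filter, Finset.mem_univ, true_and]
          rw [h.comm _ _ hx hzz, hz]
          exact hzx
      · refine Finset.sum_eq_zero fun s _ ↦ ?_
        rw [Finset.card_eq_zero.2, Nat.cast_zero, mul_zero]
        rw [Finset.filter_eq_empty_iff]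
        exact fun u _ hu ↦ hzz (hu.1 ▸ h.inv_mul_idem u)
    · simp [hx]

/-- An element of the monoid algebra generating a nil right ideal vanishes, if no maximal subgroup
has order divisible by the characteristic. -/
theorem eq_zero_of_forall_isNilpotent {inv : M → M} (h : IsInverseMap inv)
    (hG : ∀ e : M, e * e = e → ((IsInverseMap.maximalSubgroup inv e).card : K) ≠ 0)
    {a : MonoidAlgebra K M} (ha : ∀ c : M, IsNilpotent (a * single c 1)) : a = 0 := by
  classical
  by_contra hne
  have hsum : ∀ t : M, ∑ s : M with s * inv t = t * inv t, a.coeff s = 0 := by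
    intro t
    have h0 := sum_coeff_mul_card_inv_mul_eq_zero h (ha (inv t)) _ (h.mul_inv_idem t)
    simp only [h.card_fixed_eq_ite, Nat.cast_ite, Nat.cast_zero, mul_ite, mul_zero] at h0
    rw [← Finset.sum_filter, ← Finset.sum_mul] at h0
    exact (mul_eq_zero.1 h0).resolve_right (hG _ (h.mul_inv_idem t))
  obtain ⟨t, ht, hmax⟩ := a.coeff.support.exists_max_image
    (fun t ↦ Finset.card {w : M | w * (t * inv t) = w})
    (Finsupp.support_nonempty_iff.2 fun h0 ↦ hne (coeff_eq_zero.1 h0))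
  refine Finsupp.mem_support_iff.1 ht ?_
  rw [← hsum t]
  refine (Finset.sum_eq_single_of_mem t (by simp) fun s hs hst ↦ ?_).symm
  by_contra has
  refine hst ?_
  simp only [Finset.mem_filter, Finset.mem_univ, true_and] at hs
  have hyx : s * inv s * (t * inv t) = t * inv t := by rw [← hs, ← mul_assoc, h.mul_inv_mul]
  have hxy : t * inv t * (s * inv s) = t * inv t := by
    rw [h.comm _ _ (h.mul_inv_idem t) (h.mul_inv_idem s), hyx]
  have hsub : ({w : M | w * (t * inv t) = w} : Finset M) ⊆
      ({w : M | w * (s * inv s) = w} : Finset M) := by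
    intro w hw
    simp only [Finset.mem_filter, Finset.mem_univ, true_and] at hw ⊢
    rw [← hw, mul_assoc w, hxy]
  have heq := Finset.eq_of_subset_of_card_le hsub (hmax s (Finsupp.mem_support_iff.2 has))
  have hmem : s * inv s ∈ ({w : M | w * (t * inv t) = w} : Finset M) := by
    rw [heq]
    simpa using h.mul_inv_idem s
  simp only [Finset.mem_filter, Finset.mem_univ, true_and] at hmem
  rw [← h.mul_inv_mul s, ← hmem, hyx, h.mul_inv_mul_of_mul_inv_eq hs]

theorem isSemisimpleRing_of_card_maximalSubgroup_ne_zero {inv : M → M} (h : IsInverseMap inv)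
    (hG : ∀ e : M, e * e = e → ((IsInverseMap.maximalSubgroup inv e).card : K) ≠ 0) :
    IsSemisimpleRing (MonoidAlgebra K M) := by
  have : Module.Finite K (MonoidAlgebra K M) := .of_basis (MonoidAlgebra.basis M K)
  have : IsArtinianRing (MonoidAlgebra K M) := .of_finite K _
  rw [IsArtinianRing.isSemisimpleRing_iff_jacobson, eq_bot_iff]
  intro a ha
  obtain ⟨n, hn⟩ := IsSemiprimaryRing.isNilpotent (R := MonoidAlgebra K M)
  refine eq_zero_of_forall_isNilpotent h hG fun c ↦ ⟨n, ?_⟩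
  have := Ideal.pow_mem_pow (Ideal.mul_mem_right (single c 1) _ ha) n
  rwa [hn] at this

/-- Semisimple rings are von Neumann regular. -/
theorem _root_.IsSemisimpleRing.exists_mul_mul_eq {R : Type*} [Ring R] [IsSemisimpleRing R]
    (a : R) : ∃ b, a * b * a = a := by
  obtain ⟨f, hf, hI⟩ := IsSemisimpleRing.ideal_eq_span_idempotent (Ideal.span {a})
  obtain ⟨b, hb⟩ := Ideal.mem_span_singleton'.1 (hI ▸ Ideal.mem_span_singleton_self f : f ∈ _)
  obtain ⟨y, hy⟩ := Ideal.mem_span_singleton'.1 (hI ▸ Ideal.mem_span_singleton_self a : a ∈ _)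
  exact ⟨b, by rw [mul_assoc, hb, ← hy, mul_assoc, hf.eq]⟩

theorem coeff_single_mul_maximalSubgroup {inv : M → M} (h : IsInverseMap inv) {e g : M}
    (hg : g ∈ IsInverseMap.maximalSubgroup inv e) (w : MonoidAlgebra K M) :
    (single g 1 * w * single e 1).coeff e = (single e 1 * w * single g 1).coeff e := by
  classical
  obtain ⟨hg1, hg2⟩ := IsInverseMap.mem_maximalSubgroup.1 hg
  have hge := h.mul_idem_of_mem_maximalSubgroup hg
  have heg := h.idem_mul_of_mem_maximalSubgroup hg
  have hig := h.mul_idem_of_mem_maximalSubgroup (h.inv_mem_maximalSubgroup hg)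
  induction w using induction_linear with
  | zero => simp
  | add a b ha hb => simp only [mul_add, add_mul, coeff_add, Finsupp.add_apply, ha, hb]
  | single s r =>
    have : g * s * e = e ↔ e * s * g = e := by
      constructor
      · intro hs
        calc e * s * g = inv g * (g * s * e) * g := by
              rw [mul_assoc (inv g), mul_assoc _ e g, heg, mul_assoc g, ← mul_assoc (inv g), hg2,
                mul_assoc]
          _ = e := by rw [hs, hig, hg2]
      · intro hs
        calc g * s * e = g * (e * s * g) * inv g := by
              rw [mul_assoc g (e * s * g), mul_assoc _ g, hg1, mul_assoc e, ← mul_assoc g e, hge,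
                mul_assoc]
          _ = e := by rw [hs, hge, hg1]
    simp [Finsupp.single_apply, this]

theorem card_maximalSubgroup_ne_zero {inv : M → M} (h : IsInverseMap inv)
    [IsSemisimpleRing (MonoidAlgebra K M)] {e : M} (he : e * e = e) :
    ((IsInverseMap.maximalSubgroup inv e).card : K) ≠ 0 := by
  classical
  intro h0
  let a : MonoidAlgebra K M := ∑ g ∈ IsInverseMap.maximalSubgroup inv e, single g 1
  have hae : a.coeff e = 1 := by
    simp [a, Finsupp.single_apply, h.idem_mem_maximalSubgroup he]
  have hag : ∀ g ∈ IsInverseMap.maximalSubgroup inv e, a * single g 1 = a := by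
    intro g hg
    obtain ⟨hg1, hg2⟩ := IsInverseMap.mem_maximalSubgroup.1 hg
    simp only [a, Finset.sum_mul, single_mul_single, mul_one]
    refine Finset.sum_nbij' (· * g) (· * inv g)
      (fun s hs ↦ h.mul_mem_maximalSubgroup hs hg)
      (fun s hs ↦ h.mul_mem_maximalSubgroup hs (h.inv_mem_maximalSubgroup hg))
      (fun s hs ↦ ?_) (fun s hs ↦ ?_) fun s hs ↦ rfl
    · rw [mul_assoc, hg1, h.mul_idem_of_mem_maximalSubgroup hs]
    · rw [mul_assoc, hg2, h.mul_idem_of_mem_maximalSubgroup hs]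
  obtain ⟨b, hb⟩ := IsSemisimpleRing.exists_mul_mul_eq a
  have key : (a * (b * a)).coeff e = 0 := by
    calc (a * (b * a)).coeff e
        = ∑ g ∈ IsInverseMap.maximalSubgroup inv e, (single g 1 * (b * a) * single e 1).coeff e := by
          rw [← Finsupp.finsetSum_apply, ← coeff_sum, ← Finset.sum_mul, ← Finset.sum_mul,
            mul_assoc a, mul_assoc b, hag e (h.idem_mem_maximalSubgroup he)]
      _ = ∑ g ∈ IsInverseMap.maximalSubgroup inv e, (single e 1 * (b * a)).coeff e := by
          refine Finset.sum_congr rfl fun g hg ↦ ?_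
          rw [coeff_single_mul_maximalSubgroup h hg, mul_assoc, mul_assoc b, hag g hg]
      _ = 0 := by rw [Finset.sum_const, nsmul_eq_mul, h0, zero_mul]
  rw [← mul_assoc, hb, hae] at key
  exact one_ne_zero key

end MonoidAlgebra


/-- The monoid algebra of a finite inverse monoid over a field of prime characteristic `p`
is semisimple if and only if `p` divides the order of no maximal subgroup. -/
theorem monoidAlgebra_isSemisimpleRing_iff_charP {M : Type*} [Monoid M] [Fintype M]
    (inv : M → M)
    (hinv1 : ∀ s : M, s * inv s * s = s)
    (hinv2 : ∀ s : M, inv s * s * inv s = inv s)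
    (hcomm : ∀ e f : M, e * e = e → f * f = f → e * f = f * e)
    (K : Type*) [Field K] (p : ℕ) (hp : p.Prime) [CharP K p] :
    IsSemisimpleRing (MonoidAlgebra K M) ↔
      ∀ e : M, e * e = e →
        ¬ (p ∣ Nat.card {s : M // s * inv s = e ∧ inv s * s = e}) := by
  have h : IsInverseMap inv := ⟨hinv1, hinv2, hcomm⟩
  simp only [IsInverseMap.card_maximalSubgroup, ← CharP.cast_eq_zero_iff K p]
  exact ⟨fun _ _ he ↦ MonoidAlgebra.card_maximalSubgroup_ne_zero h he,
    MonoidAlgebra.isSemisimpleRing_of_card_maximalSubgroup_ne_zero h⟩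
end

section
/- Let M be a finite inverse monoid, K a field of characteristic zero, and let ρ : M →* (V →ₗ[K] V) and σ : M →* (W →ₗ[K] W) be representations of M on finite-dimensional K-vector spaces V and W. If the characters agree, i.e. the trace of ρ(m) equals the trace of σ(m) for every m ∈ M, then the two representations are equivalent: the corresponding modules over MonoidAlgebra K M are isomorphic (there is a MonoidAlgebra K M-linear equivalence between the module attached to ρ and the module attached to σ). -/
/-- A monoid in which `s⁻¹` is a generalized inverse of `s` and idempotents commute. -/
class IsInverseMonoid (M : Type*) [Monoid M] [Inv M] : Prop where
  mul_inv_mul (s : M) : s * s⁻¹ * s = s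
  inv_mul_inv (s : M) : s⁻¹ * s * s⁻¹ = s⁻¹
  idem_comm (e f : M) : e * e = e → f * f = f → e * f = f * e

namespace IsInverseMonoid

variable {M : Type*} [Monoid M] [Inv M] [IsInverseMonoid M]

theorem idem_mul_inv (s : M) : s * s⁻¹ * (s * s⁻¹) = s * s⁻¹ := by
  rw [← mul_assoc, mul_inv_mul]

theorem idem_inv_mul (s : M) : s⁻¹ * s * (s⁻¹ * s) = s⁻¹ * s := by
  rw [← mul_assoc, inv_mul_inv]

/-- Generalized inverses are unique. -/
theorem eq_inv_of_mul {s t : M} (h1 : s * t * s = s) (h2 : t * s * t = t) : t = s⁻¹ := by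
  have a := idem_comm (s * t) (s * s⁻¹) (by rw [← mul_assoc, h1]) (idem_mul_inv s)
  have b := idem_comm (t * s) (s⁻¹ * s) (by rw [← mul_assoc, h2]) (idem_inv_mul s)
  have a' : s * s⁻¹ = s * t := by
    rw [← mul_assoc, h1, ← mul_assoc, mul_inv_mul] at a
    exact a
  have b' : t * s = s⁻¹ * s := by
    rw [mul_assoc t, ← mul_assoc s, mul_inv_mul, mul_assoc s⁻¹, ← mul_assoc s t, h1] at b
    exact b
  rw [← h2, b', mul_assoc, ← a', ← mul_assoc, inv_mul_inv]

theorem inv_of_idem {e : M} (he : e * e = e) : e⁻¹ = e :=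
  (eq_inv_of_mul (by rw [he, he]) (by rw [he, he])).symm

theorem mul_inv_rev (s t : M) : (s * t)⁻¹ = t⁻¹ * s⁻¹ := by
  have h := idem_comm (t * t⁻¹) (s⁻¹ * s) (idem_mul_inv t) (idem_inv_mul s)
  refine (eq_inv_of_mul ?_ ?_).symm
  · calc s * t * (t⁻¹ * s⁻¹) * (s * t) = s * (t * t⁻¹ * (s⁻¹ * s)) * t := by simp only [mul_assoc]
      _ = (s * s⁻¹ * s) * (t * t⁻¹ * t) := by rw [h]; simp only [mul_assoc]
      _ = s * t := by rw [mul_inv_mul, mul_inv_mul]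
  · calc t⁻¹ * s⁻¹ * (s * t) * (t⁻¹ * s⁻¹) = t⁻¹ * (s⁻¹ * s * (t * t⁻¹)) * s⁻¹ := by
          simp only [mul_assoc]
      _ = (t⁻¹ * t * t⁻¹) * (s⁻¹ * s * s⁻¹) := by rw [← h]; simp only [mul_assoc]
      _ = t⁻¹ * s⁻¹ := by rw [inv_mul_inv, inv_mul_inv]

theorem inv_inv (s : M) : s⁻¹⁻¹ = s :=
  (eq_inv_of_mul (inv_mul_inv s) (mul_inv_mul s)).symm

theorem idem_mul_eq_of_mul_mul_eq {e f : M} (he : e * e = e) (hf : f * f = f) (h : e * f * e = e) :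
    e * f = e := by
  rw [mul_assoc, ← idem_comm e f he hf, ← mul_assoc, he] at h
  exact h

/-- If `t * t⁻¹` restricts `s` to `t`, then it lies below `s * s⁻¹`. -/
theorem mul_inv_mul_mul_inv_of_restrict {s t : M} (h : t * t⁻¹ * s = t) :
    t * t⁻¹ * (s * s⁻¹) = t * t⁻¹ := by
  refine idem_mul_eq_of_mul_mul_eq (idem_mul_inv t) (idem_mul_inv s) ?_
  have h1 : t * t⁻¹ * s * (t * t⁻¹ * s)⁻¹ = t * t⁻¹ := by rw [h]
  rwa [mul_inv_rev, inv_of_idem (idem_mul_inv t), ← mul_assoc, mul_assoc (t * t⁻¹) s] at h1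

variable (M) in
/-- The natural partial order: `s ≤ t` when `s` is the restriction of `t` by an idempotent. -/
abbrev naturalOrder : PartialOrder M where
  le s t := s * s⁻¹ * t = s
  le_refl := mul_inv_mul
  le_trans s t r hst htr := by
    calc s * s⁻¹ * r = s * s⁻¹ * (t * t⁻¹ * r) := by
          rw [← mul_assoc _ _ r, mul_inv_mul_mul_inv_of_restrict hst]
      _ = s := by rw [htr, hst]
  le_antisymm s t hst hts := by
    calc s = s * s⁻¹ * (t * t⁻¹ * s) := by rw [hts, hst]
      _ = t * t⁻¹ * (s * s⁻¹ * s) := by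
        rw [← mul_assoc, idem_comm _ _ (idem_mul_inv s) (idem_mul_inv t), mul_assoc]
      _ = t := by rw [mul_inv_mul, hts]

/-- `s * u⁻¹` fixes `t` exactly when `s` and `u` have a common restriction with the same range
idempotent as `t`. -/
theorem mul_inv_mul_eq_iff (s u t : M) :
    s * u⁻¹ * t = t ↔
      ∃ y : M, y * y⁻¹ * s = y ∧ y * y⁻¹ * u = y ∧ t * t⁻¹ = y * y⁻¹ := by
  constructor
  · intro h
    obtain ⟨e, he⟩ : ∃ e, e = t * t⁻¹ := ⟨_, rfl⟩
    have ee : e * e = e := he ▸ idem_mul_inv t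
    have h1 : s * u⁻¹ * e = e := by rw [he, ← mul_assoc, h]
    have h2 : e * u * s⁻¹ = e := by
      simpa only [mul_inv_rev, inv_inv, inv_of_idem ee, ← mul_assoc] using congrArg (·⁻¹) h1
    have hf : e * (u * s⁻¹ * (u * s⁻¹)⁻¹) = e := by
      refine idem_mul_eq_of_mul_mul_eq ee (idem_mul_inv _) ?_
      rw [mul_inv_rev, inv_inv]
      calc e * (u * s⁻¹ * (s * u⁻¹)) * e = e * u * s⁻¹ * (s * u⁻¹ * e) := by simp only [mul_assoc]
        _ = e := by rw [h1, h2, ee]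
    rw [mul_inv_rev, inv_inv] at hf
    have hu : e * (u * u⁻¹) = e := by
      calc e * (u * u⁻¹) = e * (u * s⁻¹ * (s * u⁻¹)) * (u * u⁻¹) := by rw [hf]
        _ = e * (u * s⁻¹ * (s * (u⁻¹ * u * u⁻¹))) := by simp only [mul_assoc]
        _ = e := by rw [inv_mul_inv, hf]
    have hsu : e * s = e * u := by
      calc e * s = e * u * s⁻¹ * s := by rw [h2]
        _ = e * (u * u⁻¹ * u) * s⁻¹ * s := by rw [mul_inv_mul]
        _ = e * u * (u⁻¹ * u * (s⁻¹ * s)) := by simp only [mul_assoc]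
        _ = e * (u * s⁻¹ * (s * u⁻¹)) * u := by
          rw [idem_comm _ _ (idem_inv_mul u) (idem_inv_mul s)]; simp only [mul_assoc]
        _ = e * u := by rw [hf]
    have hy : e * u * (e * u)⁻¹ = e := by
      rw [mul_inv_rev, inv_of_idem ee]
      calc e * u * (u⁻¹ * e) = e * (u * u⁻¹) * e := by simp only [mul_assoc]
        _ = e := by rw [hu, ee]
    exact ⟨e * u, by rw [hy, hsu], by rw [hy], by rw [hy, he]⟩
  · rintro ⟨y, hs, hu, hy⟩
    have hss : s * s⁻¹ * (y * y⁻¹) = y * y⁻¹ := by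
      rw [← idem_comm _ _ (idem_mul_inv y) (idem_mul_inv s), mul_inv_mul_mul_inv_of_restrict hs]
    have inv_y {v : M} (hv : y * y⁻¹ * v = y) : v⁻¹ * (y * y⁻¹) = y⁻¹ := by
      rw [← inv_of_idem (idem_mul_inv y), ← mul_inv_rev, hv]
    calc s * u⁻¹ * t = s * u⁻¹ * (t * t⁻¹ * t) := by rw [mul_inv_mul]
      _ = s * (u⁻¹ * (y * y⁻¹)) * t := by rw [hy]; simp only [mul_assoc]
      _ = s * s⁻¹ * (y * y⁻¹) * t := by rw [inv_y hu, mul_assoc s s⁻¹, inv_y hs]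
      _ = t := by rw [hss, ← hy, mul_inv_mul]

open scoped Classical in
/-- The number of fixed points of `s * u⁻¹`, counted through the common restrictions of `s`, `u`. -/
theorem card_fixed_mul_inv [Fintype M] (s u : M) :
    Fintype.card {t : M // s * u⁻¹ * t = t} =
      ∑ y : M, if y * y⁻¹ * u = y then
        (if y * y⁻¹ * s = y then Fintype.card {t : M // t * t⁻¹ = y * y⁻¹} else 0) else 0 := by
  have h (t : M) : (if s * u⁻¹ * t = t then 1 else 0) =
      ∑ y : M, if y * y⁻¹ * u = y then
        (if y * y⁻¹ * s = y then (if t * t⁻¹ = y * y⁻¹ then 1 else 0) else 0) else 0 := by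
    simp only [mul_inv_mul_eq_iff, ← ite_and]
    split_ifs with ht
    · obtain ⟨y, hs, hu, hy⟩ := ht
      rw [Finset.sum_eq_single y, if_pos ⟨hu, hs, hy⟩]
      · rintro z - hz
        refine if_neg fun ⟨_, hzs, hzt⟩ ↦ hz ?_
        rw [← hzs, ← hzt, hy, hs]
      · simp
    · exact (Finset.sum_eq_zero fun y _ ↦ if_neg fun ⟨hu, hs, hy⟩ ↦ ht ⟨y, hs, hu, hy⟩).symm
  simp only [Fintype.card_subtype, Finset.card_filter, h]
  rw [Finset.sum_comm]
  simp only [Finset.sum_ite_irrel, Finset.sum_const_zero]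

end IsInverseMonoid

/-- Injectivity of the zeta transform on a finite partial order. -/
theorem eq_zero_of_sum_le_eq_zero {P K : Type*} [PartialOrder P] [Fintype P] [AddCommMonoid K]
    [DecidableLE P] {f : P → K} (h : ∀ u, ∑ y, (if y ≤ u then f y else 0) = 0) : f = 0 := by
  have : WellFoundedLT P := Finite.to_wellFoundedLT
  funext u
  induction u using WellFoundedLT.induction with
  | _ u ih =>
  rw [Pi.zero_apply, ← h u, Finset.sum_eq_single u, if_pos le_rfl]
  · intro y _ hy
    split_ifs with hyu
    · exact ih y (lt_of_le_of_ne hyu hy)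
    · rfl
  · simp

namespace MonoidAlgebra

variable {M K : Type*} [Monoid M] [Fintype M] [Field K]

open scoped Classical in
theorem trace_lmul_single (m : M) :
    LinearMap.trace K (MonoidAlgebra K M) (Algebra.lmul K _ (single m 1)) =
      Fintype.card {t : M // m * t = t} := by
  rw [LinearMap.trace_eq_matrix_trace K (MonoidAlgebra.basis M K)]
  simp [Matrix.trace, LinearMap.toMatrix_apply, Fintype.card_subtype, basis, single_mul_single,
    coeff_single, Finsupp.single_apply, Finset.sum_boole]

variable [CharZero K] [Inv M] [IsInverseMonoid M]

/-- The trace form of the regular representation is nondegenerate. -/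
theorem eq_zero_of_trace_lmul_mul_eq_zero (a : MonoidAlgebra K M)
    (h : ∀ x, LinearMap.trace K (MonoidAlgebra K M) (Algebra.lmul K _ (a * x)) = 0) : a = 0 := by
  classical
  let _ := IsInverseMonoid.naturalOrder M
  have ha : a = ∑ s, a.coeff s • single s (1 : K) := ((MonoidAlgebra.basis M K).sum_repr a).symm
  set c : M → K := fun y ↦ Fintype.card {t : M // t * t⁻¹ = y * y⁻¹}
  have hc0 (y : M) : c y ≠ 0 :=
    have : Nonempty {t : M // t * t⁻¹ = y * y⁻¹} := ⟨y, rfl⟩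
    Nat.cast_ne_zero.mpr Fintype.card_ne_zero
  have h1 : (fun y ↦ ∑ s, if y ≤ s then a.coeff s * c y else 0) = 0 := by
    refine eq_zero_of_sum_le_eq_zero fun u ↦ ?_
    refine Eq.trans ?_ (h (single u⁻¹ 1))
    conv_rhs => rw [ha]
    simp only [Finset.sum_mul, smul_mul_assoc, map_sum, map_smul, single_mul_single, mul_one,
      trace_lmul_single, IsInverseMonoid.card_fixed_mul_inv, Nat.cast_sum, Nat.cast_ite,
      smul_eq_mul, Finset.mul_sum, Nat.cast_zero, mul_ite, mul_zero]
    rw [Finset.sum_comm]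
    refine Finset.sum_congr rfl fun y _ ↦ ?_
    simp only [Finset.sum_ite_irrel, Finset.sum_const_zero]
    rfl
  have h2 : a.coeff = (0 : M → K) := by
    refine eq_zero_of_sum_le_eq_zero (P := Mᵒᵈ) fun y ↦ ?_
    have h3 := congrFun h1 (OrderDual.ofDual y)
    simp only [← ite_zero_mul, ← Finset.sum_mul, Pi.zero_apply, mul_eq_zero, hc0, or_false] at h3
    exact h3
  exact coeff_injective (DFunLike.coe_injective h2)

/-- The algebra of a finite inverse monoid over a field of characteristic zero is semisimple. -/
instance isSemisimpleRing_of_isInverseMonoid : IsSemisimpleRing (MonoidAlgebra K M) := by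
  have : IsArtinianRing (MonoidAlgebra K M) := .of_finite K _
  rw [IsArtinianRing.isSemisimpleRing_iff_jacobson, eq_bot_iff, ← Ideal.jacobson_bot]
  intro a ha
  refine eq_zero_of_trace_lmul_mul_eq_zero a fun x ↦ ?_
  have hxa : x * a ∈ Ideal.jacobson (⊥ : Ideal (MonoidAlgebra K M)) := Ideal.mul_mem_left _ x ha
  obtain ⟨n, hn⟩ := IsArtinianRing.isNilpotent_jacobson_bot (R := MonoidAlgebra K M)
  have hnil : IsNilpotent (x * a) := ⟨n, by simpa [hn] using Ideal.pow_mem_pow hxa n⟩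
  rw [map_mul, LinearMap.trace_mul_comm, ← map_mul]
  exact (LinearMap.isNilpotent_trace_of_isNilpotent (hnil.map (Algebra.lmul K _))).eq_zero

end MonoidAlgebra

namespace IsSemisimpleRing

variable (K : Type*) {A : Type*} [Field K] [Ring A] [Algebra K A]

theorem trace_lsmul_prod (V W : Type*) [AddCommGroup V] [Module K V] [Module A V]
    [IsScalarTower K A V] [FiniteDimensional K V] [AddCommGroup W] [Module K W] [Module A W]
    [IsScalarTower K A W] [FiniteDimensional K W] (a : A) :
    LinearMap.trace K (V × W) (Algebra.lsmul K K (V × W) a) =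
      LinearMap.trace K V (Algebra.lsmul K K V a) + LinearMap.trace K W (Algebra.lsmul K K W a) := by
  rw [← LinearMap.trace_prodMap']
  rfl

theorem trace_lsmul_congr {V W : Type*} [AddCommGroup V] [Module K V] [Module A V]
    [IsScalarTower K A V] [AddCommGroup W] [Module K W] [Module A W]
    [IsScalarTower K A W] (f : V ≃ₗ[A] W) (a : A) :
    LinearMap.trace K V (Algebra.lsmul K K V a) = LinearMap.trace K W (Algebra.lsmul K K W a) := by
  rw [← LinearMap.trace_conj' _ (f.restrictScalars K)]
  congr 1
  ext w
  simp [LinearEquiv.conj_apply]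

variable [CharZero K] [IsSemisimpleRing A]

/-- An idempotent `e` with `S ≃ A e` has nonzero trace on exactly the modules containing `S`. -/
theorem exists_injective_of_trace_eq {V W : Type*} [AddCommGroup V] [Module K V] [Module A V]
    [IsScalarTower K A V] [FiniteDimensional K V] [AddCommGroup W] [Module K W] [Module A W]
    [IsScalarTower K A W] [FiniteDimensional K W]
    (h : ∀ a : A, LinearMap.trace K V (Algebra.lsmul K K V a) =
      LinearMap.trace K W (Algebra.lsmul K K W a))
    (S : Submodule A V) [IsSimpleModule A S] : ∃ f : S →ₗ[A] W, Function.Injective f := by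
  obtain ⟨I, ⟨φ⟩⟩ := exists_linearEquiv_ideal_of_isSimpleModule A S
  obtain ⟨e, he, rfl⟩ := ideal_eq_span_idempotent I
  have he_mem : e ∈ Ideal.span {e} := Ideal.mem_span_singleton_self e
  have he_ne : e ≠ 0 := by
    rintro rfl
    have := IsSimpleModule.nontrivial A S
    have : Subsingleton (Ideal.span {(0 : A)}) := by
      rw [Ideal.span_singleton_eq_bot.mpr rfl]; infer_instance
    exact not_subsingleton S φ.toEquiv.subsingleton
  have hV : Algebra.lsmul K K V e ≠ 0 := fun h0 ↦ by
    have h1 : e • (φ.symm ⟨e, he_mem⟩ : V) = 0 := LinearMap.congr_fun h0 _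
    rw [← Submodule.coe_smul, ← map_smul] at h1
    have h2 : e • (⟨e, he_mem⟩ : Ideal.span {e}) = ⟨e, he_mem⟩ := Subtype.ext he
    rw [h2, Submodule.coe_eq_zero, LinearEquiv.map_eq_zero_iff] at h1
    exact he_ne (congrArg Subtype.val h1)
  have hW : Algebra.lsmul K K W e ≠ 0 := by
    have idemW : IsIdempotentElem (Algebra.lsmul K K W e) := he.map _
    have idemV : IsIdempotentElem (Algebra.lsmul K K V e) := he.map _
    rw [ne_eq, ← LinearMap.IsIdempotentElem.trace_eq_zero_iff idemW, ← h,
      LinearMap.IsIdempotentElem.trace_eq_zero_iff idemV]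
    exact hV
  obtain ⟨w, hw⟩ : ∃ w : W, e • w ≠ 0 := by
    by_contra! h0
    exact hW (LinearMap.ext h0)
  let f : S →ₗ[A] W := LinearMap.toSpanSingleton A W w ∘ₗ (Ideal.span {e}).subtype ∘ₗ φ.toLinearMap
  refine ⟨f, f.injective_or_eq_zero.resolve_right fun h0 ↦ hw ?_⟩
  simpa [f] using LinearMap.congr_fun h0 (φ.symm ⟨e, he_mem⟩)

/-- Over a semisimple algebra in characteristic zero, finite-dimensional modules with the same
character are isomorphic. -/
theorem nonempty_linearEquiv_of_trace_eq {V W : Type*} [AddCommGroup V] [Module K V] [Module A V]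
    [IsScalarTower K A V] [FiniteDimensional K V] [AddCommGroup W] [Module K W] [Module A W]
    [IsScalarTower K A W] [FiniteDimensional K W]
    (h : ∀ a : A, LinearMap.trace K V (Algebra.lsmul K K V a) =
      LinearMap.trace K W (Algebra.lsmul K K W a)) :
    Nonempty (V ≃ₗ[A] W) := by
  induction hn : Module.finrank K V using Nat.strong_induction_on generalizing V W with
  | _ n ih =>
  rcases subsingleton_or_nontrivial V with hV | hV
  · have h1 : (Module.finrank K V : K) = Module.finrank K W := by
      simpa only [map_one, LinearMap.trace_one] using h 1
    have : Subsingleton W := by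
      rw [← Module.finrank_eq_zero_iff_of_free (R := K), ← Nat.cast_eq_zero (R := K), ← h1,
        Module.finrank_zero_of_subsingleton, Nat.cast_zero]
    exact ⟨0, 0, fun _ ↦ Subsingleton.elim _ _, fun _ ↦ Subsingleton.elim _ _⟩
  obtain ⟨S, hS⟩ := IsSemisimpleModule.exists_simple_submodule A V
  obtain ⟨f, hf⟩ := exists_injective_of_trace_eq K h S
  obtain ⟨T, hT⟩ := exists_isCompl S
  obtain ⟨T', hT'⟩ := exists_isCompl (LinearMap.range f)
  let eV := S.prodEquivOfIsCompl T hT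
  let eW := ((LinearEquiv.ofInjective f hf).prodCongr (.refl A T')).trans
    (Submodule.prodEquivOfIsCompl _ T' hT')
  have (U : Submodule A V) : FiniteDimensional K U :=
    inferInstanceAs (FiniteDimensional K (U.restrictScalars K))
  have (U : Submodule A W) : FiniteDimensional K U :=
    inferInstanceAs (FiniteDimensional K (U.restrictScalars K))
  have hST : Module.finrank K S + Module.finrank K T = n := by
    rw [← Module.finrank_prod, (eV.restrictScalars K).finrank_eq, hn]
  have := IsSimpleModule.nontrivial A S
  have hpos : 0 < Module.finrank K S := Module.finrank_pos
  obtain ⟨g⟩ := ih (Module.finrank K T) (by omega) (V := T) (W := T') (fun a ↦ by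
    have := h a
    rwa [← trace_lsmul_congr K eV, ← trace_lsmul_congr K eW, trace_lsmul_prod, trace_lsmul_prod,
      add_right_inj] at this) rfl
  exact ⟨eV.symm.trans (((LinearEquiv.refl A S).prodCongr g).trans eW)⟩

end IsSemisimpleRing

/-- Representations with equal characters have equal traces on the whole monoid algebra. -/
theorem Representation.trace_lsmul_eq_of_char_eq {K M V W : Type*} [Field K] [Monoid M]
    [AddCommGroup V] [Module K V] [AddCommGroup W] [Module K W]
    (ρ : Representation K M V) (σ : Representation K M W)
    (h : ∀ m : M, LinearMap.trace K V (ρ m) = LinearMap.trace K W (σ m)) (a : MonoidAlgebra K M) :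
    LinearMap.trace K ρ.asModule (Algebra.lsmul K K ρ.asModule a) =
      LinearMap.trace K σ.asModule (Algebra.lsmul K K σ.asModule a) := by
  change LinearMap.trace K V (ρ.asAlgebraHom a) = LinearMap.trace K W (σ.asAlgebraHom a)
  induction a using MonoidAlgebra.induction_on with
  | of m => simpa using h m
  | add f g hf hg => simp only [map_add, hf, hg]
  | smul c f hf => simp only [map_smul, hf]

/-- Two finite-dimensional representations of a finite inverse monoid over a field of
characteristic zero having the same character are equivalent. -/
theorem representations_equiv_of_char_eq {M : Type*} [Monoid M] [Fintype M]
    (inv : M → M)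
    (hinv1 : ∀ s : M, s * inv s * s = s)
    (hinv2 : ∀ s : M, inv s * s * inv s = inv s)
    (hcomm : ∀ e f : M, e * e = e → f * f = f → e * f = f * e)
    {K : Type*} [Field K] [CharZero K]
    {V W : Type*} [AddCommGroup V] [Module K V] [FiniteDimensional K V]
    [AddCommGroup W] [Module K W] [FiniteDimensional K W]
    (ρ : Representation K M V) (σ : Representation K M W)
    (hchar : ∀ m : M, LinearMap.trace K V (ρ m) = LinearMap.trace K W (σ m)) :
    Nonempty (ρ.asModule ≃ₗ[MonoidAlgebra K M] σ.asModule) := by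
  let _ : Inv M := ⟨inv⟩
  have : IsInverseMonoid M := ⟨hinv1, hinv2, hcomm⟩
  exact IsSemisimpleRing.nonempty_linearEquiv_of_trace_eq K (ρ.trace_lsmul_eq_of_char_eq σ hchar)
end

section
/- Let M be a finite inverse monoid carrying a partial order (with decidable equality and locally finite order structure) whose order relation satisfies s ≤ t iff s = e*t for some idempotent e. Let e be an idempotent and let g ∈ M satisfy g * inv g = e = inv g * g (g is in the maximal subgroup at e). Then the map f ↦ f*g is an order isomorphism from Set.Iic e onto Set.Iic g, and consequently μ(f*g, g) = μ(f, e) for every f ≤ e, where μ is the integer-valued Möbius function of the poset M. -/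
/-- The Möbius function is invariant under order isomorphisms of principal lower sets. -/
theorem IncidenceAlgebra.mu_orderIso_Iic (𝕜 : Type*) [Ring 𝕜] {α β : Type*}
    [PartialOrder α] [LocallyFiniteOrder α] [DecidableEq α]
    [PartialOrder β] [LocallyFiniteOrder β] [DecidableEq β]
    {a : α} {b : β} (φ : Set.Iic a ≃o Set.Iic b) (x : Set.Iic a) :
    mu 𝕜 (φ x : β) b = mu 𝕜 (x : α) a := by
  have hφ : φ ⟨a, le_rfl⟩ = ⟨b, le_rfl⟩ := map_top φ
  induction hn : (Finset.Icc (x : α) a).card using Nat.strong_induction_on generalizing x with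
  | _ n ih =>
  subst hn
  by_cases hx : (x : α) = a
  · obtain rfl : x = ⟨a, le_rfl⟩ := Subtype.ext hx
    simp [hφ]
  · have hx' : (φ x : β) ≠ b := fun h ↦
      hx (congrArg Subtype.val (φ.injective ((Subtype.ext h).trans hφ.symm)))
    rw [mu_eq_neg_sum_Ioc_of_ne hx, mu_eq_neg_sum_Ioc_of_ne hx', neg_inj]
    symm
    refine Finset.sum_bij (fun y hy ↦ (φ ⟨y, (Finset.mem_Ioc.1 hy).2⟩ : β)) ?_ ?_ ?_ ?_
    · intro y hy
      exact Finset.mem_Ioc.2 ⟨φ.lt_iff_lt.2 (Finset.mem_Ioc.1 hy).1, (φ _).2⟩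
    · intro y hy z hz h
      exact congrArg Subtype.val (φ.injective (Subtype.ext h))
    · intro z hz
      obtain ⟨h₁, h₂⟩ := Finset.mem_Ioc.1 hz
      have h : x < φ.symm ⟨z, h₂⟩ := φ.lt_symm_apply.2 h₁
      exact ⟨φ.symm ⟨z, h₂⟩, Finset.mem_Ioc.2 ⟨h, (φ.symm _).2⟩,
        congrArg Subtype.val (φ.apply_symm_apply ⟨z, h₂⟩)⟩
    · intro y hy
      obtain ⟨h₁, h₂⟩ := Finset.mem_Ioc.1 hy
      exact (ih _ (Finset.card_lt_card (Finset.Icc_ssubset_Icc_left x.2 h₁ le_rfl))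
        ⟨y, h₂⟩ rfl).symm

/-- In a finite inverse monoid with the natural partial order, if `g` belongs to the
maximal subgroup at the idempotent `e`, then `f ↦ f * g` is an order isomorphism from
`Set.Iic e` onto `Set.Iic g`; consequently `μ(f*g, g) = μ(f, e)` for every `f ≤ e`. -/
theorem orderIso_Iic_idem_Iic_group_elt {M : Type*} [Monoid M] [Fintype M] [DecidableEq M]
    [PartialOrder M] [LocallyFiniteOrder M]
    (inv : M → M)
    (hinv1 : ∀ s : M, s * inv s * s = s)
    (hinv2 : ∀ s : M, inv s * s * inv s = inv s)
    (hcomm : ∀ e f : M, e * e = e → f * f = f → e * f = f * e)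
    (horder : ∀ s t : M, s ≤ t ↔ ∃ e : M, e * e = e ∧ s = e * t)
    (e g : M) (he : e * e = e) (hg1 : g * inv g = e) (hg2 : inv g * g = e) :
    (∃ φ : Set.Iic e ≃o Set.Iic g, ∀ f : Set.Iic e, ((φ f : M)) = (f : M) * g) ∧
    (∀ f : M, f ≤ e → IncidenceAlgebra.mu ℤ (f * g) g = IncidenceAlgebra.mu ℤ f e) := by
  have hmono : ∀ c s t : M, s ≤ t → s * c ≤ t * c := by
    intro c s t h
    obtain ⟨k, hk, rfl⟩ := (horder _ _).1 h
    exact (horder _ _).2 ⟨k, hk, mul_assoc _ _ _⟩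
  have heg : e * g = g := by rw [← hg1, hinv1]
  have hleft : ∀ f : M, f ≤ e → f * g * inv g = f := by
    intro f h
    obtain ⟨k, -, rfl⟩ := (horder _ _).1 h
    rw [mul_assoc, hg1, mul_assoc, he]
  have hright : ∀ s : M, s ≤ g → s * inv g * g = s := by
    intro s h
    obtain ⟨k, -, rfl⟩ := (horder _ _).1 h
    rw [mul_assoc k, hg1, mul_assoc, heg]
  let φ : Set.Iic e ≃o Set.Iic g :=
    { toFun := fun f ↦ ⟨f * g, (hmono g _ _ f.2).trans_eq heg⟩
      invFun := fun s ↦ ⟨s * inv g, (hmono (inv g) _ _ s.2).trans_eq hg1⟩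
      left_inv := fun f ↦ Subtype.ext (hleft f f.2)
      right_inv := fun s ↦ Subtype.ext (hright s s.2)
      map_rel_iff' := by
        intro f f'
        refine ⟨fun h ↦ ?_, fun h ↦ hmono g _ _ h⟩
        have := hmono (inv g) _ _ (show (f : M) * g ≤ f' * g from h)
        rwa [hleft f f.2, hleft f' f'.2] at this }
  exact ⟨⟨φ, fun _ ↦ rfl⟩, fun f hf ↦ IncidenceAlgebra.mu_orderIso_Iic ℤ φ ⟨f, hf⟩⟩
end

section
/- Let α be a finite type with decidable equality and let S be a set of partial permutations of α (elements of PEquiv α α) that is closed under composition (PEquiv.trans) and under inversion (PEquiv.symm), and which is transitive: for all x, y ∈ α there is f ∈ S with f x = some y. If e and f are idempotents in S (e.trans e = e and f.trans f = f) each of minimal nonzero rank (i.e. 0 < rank e, 0 < rank f, and every g ∈ S with 0 < rank g satisfies rank e ≤ rank g and rank f ≤ rank g), then e and f are isomorphic: there exists s ∈ S with s.trans s.symm = e and s.symm.trans s = f. -/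
/-- The rank of a partial permutation: the number of points where it is defined. -/
def pequivRank {α : Type*} [Fintype α] [DecidableEq α] (f : α ≃. α) : ℕ :=
  (Finset.univ.filter fun x => (f x).isSome).card

theorem pequivRank_pos_iff {α : Type*} [Fintype α] [DecidableEq α] {f : α ≃. α} :
    0 < pequivRank f ↔ ∃ x y, f x = some y := by
  simp [pequivRank, Finset.card_pos, Finset.filter_nonempty_iff, Option.isSome_iff_exists]

/-- An idempotent partial permutation is a restriction of the identity. -/
theorem PEquiv.eq_of_idempotent_apply {α : Type*} {e : α ≃. α} (he : e.trans e = e) {x y : α}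
    (h : e x = some y) : x = y := by
  have h' := h
  rw [← he, PEquiv.trans_eq_some] at h'
  obtain ⟨z, hz, hzy⟩ := h'
  obtain rfl : z = y := Option.some.inj (hz.symm.trans h)
  exact e.inj h hzy

/-- A partial permutation of rank at least that of an idempotent `e`, and whose domain is contained
in that of `e`, has `e` as its domain idempotent. -/
theorem PEquiv.self_trans_symm_eq_of_rank_le {α : Type*} [Fintype α] [DecidableEq α]
    {e t : α ≃. α} (he : e.trans e = e) (hdom : ∀ x, (t x).isSome → (e x).isSome)
    (hrank : pequivRank e ≤ pequivRank t) : t.trans t.symm = e := by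
  have hsets := Finset.eq_of_subset_of_card_le
    (Finset.monotone_filter_right Finset.univ fun x _ => hdom x) hrank
  have hiff : ∀ x, (t x).isSome ↔ (e x).isSome := by simpa [Finset.ext_iff] using hsets
  ext x y
  rw [PEquiv.self_trans_symm, PEquiv.ofSet_eq_some_iff, Set.mem_ofPred_eq, hiff]
  constructor
  · rintro ⟨rfl, h⟩
    obtain ⟨z, hz⟩ := Option.isSome_iff_exists.1 h
    rwa [← PEquiv.eq_of_idempotent_apply he hz] at hz
  · intro h
    obtain rfl := PEquiv.eq_of_idempotent_apply he h
    exact ⟨rfl, by simp [h]⟩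

theorem PEquiv.isSome_of_isSome_trans {α β γ : Type*} {f : α ≃. β} {g : β ≃. γ} {x : α}
    (h : (f.trans g x).isSome) : (f x).isSome := by
  obtain ⟨z, hz⟩ := Option.isSome_iff_exists.1 h
  obtain ⟨y, hy, -⟩ := (PEquiv.trans_eq_some f g x z).1 hz
  simp [hy]

/-- In a transitive set of partial permutations closed under composition and inversion,
any two idempotents of minimal nonzero rank are isomorphic. -/
theorem idempotents_min_rank_isomorphic {α : Type*} [Fintype α] [DecidableEq α]
    (S : Set (α ≃. α))
    (htrans : ∀ f ∈ S, ∀ g ∈ S, f.trans g ∈ S)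
    (hsymm : ∀ f ∈ S, f.symm ∈ S)
    (htransitive : ∀ x y : α, ∃ f ∈ S, f x = some y)
    (e f : α ≃. α) (heS : e ∈ S) (hfS : f ∈ S)
    (he : e.trans e = e) (hf : f.trans f = f)
    (hepos : 0 < pequivRank e) (hfpos : 0 < pequivRank f)
    (hemin : ∀ g ∈ S, 0 < pequivRank g → pequivRank e ≤ pequivRank g)
    (hfmin : ∀ g ∈ S, 0 < pequivRank g → pequivRank f ≤ pequivRank g) :
    ∃ s ∈ S, s.trans s.symm = e ∧ s.symm.trans s = f := by
  obtain ⟨x, x', hx⟩ := pequivRank_pos_iff.1 hepos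
  obtain ⟨y, y', hy⟩ := pequivRank_pos_iff.1 hfpos
  obtain rfl := PEquiv.eq_of_idempotent_apply he hx
  obtain rfl := PEquiv.eq_of_idempotent_apply hf hy
  obtain ⟨g, hg, hgxy⟩ := htransitive x y
  have hsS : e.trans (g.trans f) ∈ S := htrans e heS _ (htrans g hg f hfS)
  have hsxy : e.trans (g.trans f) x = some y :=
    (PEquiv.trans_eq_some _ _ _ _).2 ⟨x, hx, (PEquiv.trans_eq_some _ _ _ _).2 ⟨y, hgxy, hy⟩⟩
  refine ⟨_, hsS, ?_, ?_⟩
  · exact PEquiv.self_trans_symm_eq_of_rank_le he (fun _ => PEquiv.isSome_of_isSome_trans)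
      (hemin _ hsS (pequivRank_pos_iff.2 ⟨x, y, hsxy⟩))
  · refine PEquiv.self_trans_symm_eq_of_rank_le (t := (e.trans (g.trans f)).symm) hf ?_
      (hfmin _ (hsymm _ hsS) (pequivRank_pos_iff.2 ⟨y, x, (PEquiv.eq_some_iff _).2 hsxy⟩))
    intro z hz
    rw [PEquiv.symm_trans_rev, PEquiv.symm_trans_rev, PEquiv.trans_assoc] at hz
    obtain ⟨w, hw⟩ := Option.isSome_iff_exists.1 (PEquiv.isSome_of_isSome_trans hz)
    rw [PEquiv.eq_some_iff] at hw
    obtain rfl := PEquiv.eq_of_idempotent_apply hf hw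
    simp [hw]
end

section
/- Let α be a finite type with decidable equality and let S be a set of partial permutations of α (elements of PEquiv α α) closed under PEquiv.trans and PEquiv.symm and transitive (for all x, y ∈ α there is f ∈ S with f x = some y). Equip the subtype {f // f ∈ S} with a partial order (with decidable equality and locally finite order structure) whose relation is the restriction order: f ≤ g iff for all x and a, f x = some a implies g x = some a; let μ be the integer-valued Möbius function of this finite poset. Define θ(t) = the number of fixed points of t (the number of x with t x = some x). Then for every s ∈ S, the sum Σ_{t ≤ s} θ(t)·μ(t, s) equals θ(s) if s has minimal nonzero rank (0 < rank s and rank s ≤ rank g for every g ∈ S with 0 < rank g), and equals 0 otherwise. -/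
open scoped Classical

/-- The number of fixed points of a partial permutation, as an integer. -/
def pequivFix {α : Type*} [Fintype α] [DecidableEq α] (f : α ≃. α) : ℤ :=
  ((Finset.univ.filter fun x => f x = some x).card : ℤ)

/-- The composite `f f⁻¹ g` is the restriction of `g` to the domain of `f`. -/
theorem PEquiv.trans_symm_trans_eq_some {α : Type*} {f g : α ≃. α} {x a : α} :
    (f.trans f.symm).trans g x = some a ↔ (f x).isSome ∧ g x = some a := by
  rw [PEquiv.self_trans_symm, PEquiv.trans_eq_some]
  constructor
  · rintro ⟨b, hb, hg⟩
    rw [PEquiv.ofSet_eq_some_iff] at hb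
    obtain ⟨rfl, hb⟩ := hb
    exact ⟨hb, hg⟩
  · rintro ⟨hf, hg⟩
    exact ⟨x, PEquiv.ofSet_eq_some_self_iff.2 hf, hg⟩

theorem pequivRank_pos {α : Type*} [Fintype α] [DecidableEq α] {f : α ≃. α} {x a : α}
    (h : f x = some a) : 0 < pequivRank f :=
  Finset.card_pos.2 ⟨x, by simp [h]⟩

/-- A restriction of `g` of rank at least that of `g` is `g` itself. -/
theorem PEquiv.eq_of_restrict_of_pequivRank_le {α : Type*} [Fintype α] [DecidableEq α]
    {f g : α ≃. α} (hfg : ∀ x a, f x = some a → g x = some a)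
    (h : pequivRank g ≤ pequivRank f) : f = g := by
  have hdom := Finset.eq_of_subset_of_card_le (s := Finset.univ.filter fun x => (f x).isSome)
    (t := Finset.univ.filter fun x => (g x).isSome)
    (fun x hx => by
      simp only [Finset.mem_filter, Finset.mem_univ, true_and, Option.isSome_iff_exists] at hx ⊢
      exact hx.imp fun a ha => hfg x a ha) h
  ext x : 1
  have hx := Finset.ext_iff.1 hdom x
  simp only [Finset.mem_filter, Finset.mem_univ, true_and] at hx
  cases hf : f x with
  | some a => exact (hfg x a hf).symm
  | none =>
    cases hg : g x with
    | none => rfl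
    | some b => simp [hf, hg] at hx

/-- If `f` carries the domain of `s` into that of `g`, then `s` has rank at most that
of `g`. -/
theorem pequivRank_le_of_forall_isSome_trans {α : Type*} [Fintype α] [DecidableEq α]
    {f g s : α ≃. α} (h : ∀ x, (s x).isSome → (f.trans g x).isSome) :
    pequivRank s ≤ pequivRank g := by
  have key : ∀ x, (s x).isSome → ∃ y, f x = some y ∧ (g y).isSome := by
    intro x hx
    obtain ⟨c, hc⟩ := Option.isSome_iff_exists.1 (h x hx)
    obtain ⟨y, hy, hg⟩ := (PEquiv.trans_eq_some f g x c).1 hc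
    exact ⟨y, hy, by simp [hg]⟩
  refine Finset.card_le_card_of_injOn (fun x => (f x).getD x) ?_ ?_
  · intro x hx
    obtain ⟨y, hy, hg⟩ := key x (by simpa using hx)
    simpa [hy] using hg
  · intro x hx x' hx' hxx
    obtain ⟨y, hy, -⟩ := key x (by simpa using hx)
    obtain ⟨y', hy', -⟩ := key x' (by simpa using hx')
    simp only [hy, hy', Option.getD_some] at hxx
    subst hxx
    exact f.inj hy hy'

/-- In an inverse semigroup of partial permutations ordered by restriction, the restrictions of
`s` defined at a given point of its domain have a least element. -/
theorem exists_least_restriction {α : Type*} {S : Set (α ≃. α)} [Finite ↥S]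
    (htrans : ∀ f ∈ S, ∀ g ∈ S, f.trans g ∈ S) (hsymm : ∀ f ∈ S, f.symm ∈ S)
    {s : ↥S} {x a : α} (hx : s.val x = some a) :
    ∃ m : ↥S, m.val x = some a ∧ ∀ t ≤ s, (t.val x = some a ↔ m ≤ t) := by
  have horder : ∀ f g : ↥S, f ≤ g ↔ ∀ x a, f.val x = some a → g.val x = some a :=
    fun _ _ => PEquiv.le_def
  obtain ⟨m, hm⟩ := (Set.toFinite {t : ↥S | t ≤ s ∧ t.val x = some a}).exists_minimal
    ⟨s, le_rfl, hx⟩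
  refine ⟨m, hm.prop.2, fun t hts => ⟨fun ht => ?_, fun hmt => (horder m t).1 hmt x a hm.prop.2⟩⟩
  let r : ↥S := ⟨(m.val.trans m.val.symm).trans t.val,
    htrans _ (htrans _ m.2 _ (hsymm _ m.2)) _ t.2⟩
  have hrt : r ≤ t := (horder r t).2 fun y b hy => (PEquiv.trans_symm_trans_eq_some.1 hy).2
  have hrx : r.val x = some a :=
    PEquiv.trans_symm_trans_eq_some.2 ⟨by simp [hm.prop.2], ht⟩
  have hrm : r ≤ m := (horder r m).2 fun y b hy => by
    obtain ⟨hym, hyt⟩ := PEquiv.trans_symm_trans_eq_some.1 hy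
    obtain ⟨c, hc⟩ := Option.isSome_iff_exists.1 hym
    have h1 := (horder m s).1 hm.prop.1 y c hc
    have h2 := (horder t s).1 hts y b hyt
    rw [hc, ← h1, h2]
  exact (hm.le_of_le ⟨hrt.trans hts, hrx⟩ hrm).trans hrt

/-- In a transitive inverse semigroup of partial permutations, `s` has minimal nonzero rank as
soon as no proper restriction of it is defined at a given point of its domain. -/
theorem pequivRank_le_of_no_proper_restriction {α : Type*} [Fintype α] [DecidableEq α]
    {S : Set (α ≃. α)}
    (htrans : ∀ f ∈ S, ∀ g ∈ S, f.trans g ∈ S) (hsymm : ∀ f ∈ S, f.symm ∈ S)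
    (htransitive : ∀ x y : α, ∃ f ∈ S, f x = some y)
    {s : α ≃. α} (hs : s ∈ S) {x a : α} (hx : s x = some a)
    (hmin : ∀ t ∈ S, (∀ y b, t y = some b → s y = some b) → t x = some a → t = s)
    {g : α ≃. α} (hg : g ∈ S) (hpos : 0 < pequivRank g) : pequivRank s ≤ pequivRank g := by
  obtain ⟨y, hy⟩ := Finset.card_pos.1 hpos
  obtain ⟨z, hz⟩ := Option.isSome_iff_exists.1 (Finset.mem_filter.1 hy).2
  obtain ⟨f, hf, hfx⟩ := htransitive x y
  have hfg := htrans f hf g hg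
  have hfgx : f.trans g x = some z := (PEquiv.trans_eq_some f g x z).2 ⟨y, hfx, hz⟩
  have heq := hmin _ (htrans _ (htrans _ hfg _ (hsymm _ hfg)) _ hs)
    (fun _ _ h => (PEquiv.trans_symm_trans_eq_some.1 h).2)
    (PEquiv.trans_symm_trans_eq_some.2 ⟨by simp [hfgx], hx⟩)
  refine pequivRank_le_of_forall_isSome_trans (f := f) fun w hw => ?_
  obtain ⟨c, hc⟩ := Option.isSome_iff_exists.1 hw
  rw [← heq] at hc
  exact (PEquiv.trans_symm_trans_eq_some.1 hc).1

/-- For a transitive inverse semigroup `S` of partial permutations ordered by restriction,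
the Möbius-inverted fixed-point function `h(s) = ∑_{t ≤ s} θ(t)·μ(t,s)` equals `θ(s)` if
`s` has minimal nonzero rank and `0` otherwise. -/
theorem mobius_inverted_fixed_point_character {α : Type*} [Fintype α] [DecidableEq α]
    (S : Set (α ≃. α)) [Fintype ↥S] [DecidableEq ↥S]
    [PartialOrder ↥S] [LocallyFiniteOrder ↥S]
    (htrans : ∀ f ∈ S, ∀ g ∈ S, f.trans g ∈ S)
    (hsymm : ∀ f ∈ S, f.symm ∈ S)
    (htransitive : ∀ x y : α, ∃ f ∈ S, f x = some y)
    (horder : ∀ f g : ↥S, f ≤ g ↔ ∀ (x a : α), f.val x = some a → g.val x = some a)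
    (s : ↥S) :
    (∑ t ∈ Finset.univ.filter (· ≤ s), pequivFix t.val * IncidenceAlgebra.mu ℤ t s) =
      if 0 < pequivRank s.val ∧
          ∀ g ∈ S, 0 < pequivRank g → pequivRank s.val ≤ pequivRank g
      then pequivFix s.val else 0 := by
  have hpoint : ∀ x, s.val x = some x →
      (∑ t ∈ Finset.univ.filter (fun t : ↥S => t ≤ s ∧ t.val x = some x),
        IncidenceAlgebra.mu ℤ t s) =
      if 0 < pequivRank s.val ∧
          ∀ g ∈ S, 0 < pequivRank g → pequivRank s.val ≤ pequivRank g
      then 1 else 0 := by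
    intro x hx
    obtain ⟨m, hmx, hm⟩ := exists_least_restriction htrans hsymm hx
    have hms : m ≤ s := (hm s le_rfl).1 hx
    have hset : Finset.univ.filter (fun t : ↥S => t ≤ s ∧ t.val x = some x) =
        Finset.Icc m s := by
      ext t
      simp only [Finset.mem_filter, Finset.mem_univ, true_and, Finset.mem_Icc]
      exact ⟨fun h => ⟨(hm t h.1).1 h.2, h.1⟩, fun h => ⟨h.2, (hm t h.2).2 h.1⟩⟩
    rw [hset]
    refine (@IncidenceAlgebra.sum_Icc_mu_left ℤ ↥S _ (Subtype.partialOrder _) _ _ m s).trans ?_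
    refine if_congr ⟨?_, ?_⟩ rfl rfl
    · rintro rfl
      refine ⟨pequivRank_pos hx, fun g hg hpos => ?_⟩
      refine pequivRank_le_of_no_proper_restriction htrans hsymm htransitive m.2 hx ?_ hg hpos
      intro t ht htm htx
      have hle : (⟨t, ht⟩ : ↥S) ≤ m := (horder _ _).2 htm
      exact le_antisymm (α := α ≃. α) hle ((hm _ hle).1 htx)
    · rintro ⟨-, h⟩
      exact Subtype.ext (PEquiv.eq_of_restrict_of_pequivRank_le ((horder m s).1 hms)
        (h m.val m.2 (pequivRank_pos hmx)))
  have hswap : (∑ t ∈ Finset.univ.filter (· ≤ s),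
        pequivFix t.val * IncidenceAlgebra.mu ℤ t s) =
      ∑ x ∈ Finset.univ.filter (fun x => s.val x = some x),
        ∑ t ∈ Finset.univ.filter (fun t : ↥S => t ≤ s ∧ t.val x = some x),
          IncidenceAlgebra.mu ℤ t s := by
    have hfix : ∀ t : ↥S, pequivFix t.val * IncidenceAlgebra.mu ℤ t s =
        ∑ x ∈ Finset.univ.filter (fun x => t.val x = some x), IncidenceAlgebra.mu ℤ t s := by
      intro t
      rw [Finset.sum_const, nsmul_eq_mul, pequivFix]
    rw [Finset.sum_congr rfl fun t _ => hfix t]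
    refine Finset.sum_comm' fun t x => ?_
    simp only [Finset.mem_filter, Finset.mem_univ, true_and]
    exact ⟨fun h => ⟨h, (horder t s).1 h.1 x x h.2⟩, fun h => h.1⟩
  rw [hswap, Finset.sum_congr rfl fun x hx => hpoint x (Finset.mem_filter.1 hx).2]
  rw [Finset.sum_const, nsmul_eq_mul, mul_ite, mul_one, mul_zero, pequivFix]
end

section
/- Let K be a field of characteristic zero, α a finite type with decidable equality, and S a set of partial permutations of α (elements of PEquiv α α) that is closed under PEquiv.trans and PEquiv.symm, transitive (for all x, y ∈ α there is f ∈ S with f x = some y), and contains an element of rank 1 (some f ∈ S for which exactly one x ∈ α has (f x).isSome). Then the rook matrix representation of S on the space α → K is irreducible: every K-subspace W of (α → K) satisfying vecMul v (toMatrix f) ∈ W for all f ∈ S and v ∈ W is either the zero subspace or the whole space. -/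
theorem PEquiv.exists_eq_single_of_card_eq_one {α β : Type*} [Fintype α] [DecidableEq α]
    [DecidableEq β] (f : α ≃. β)
    (hf : (Finset.univ.filter fun x => (f x).isSome).card = 1) :
    ∃ a b, f = PEquiv.single a b := by
  obtain ⟨a, ha⟩ := Finset.card_eq_one.mp hf
  have isSome_iff (x : α) : (f x).isSome ↔ x = a := by
    simpa using Finset.ext_iff.mp ha x
  obtain ⟨b, hb⟩ := Option.isSome_iff_exists.mp ((isSome_iff a).mpr rfl)
  refine ⟨a, b, PEquiv.ext fun x => ?_⟩
  by_cases hx : x = a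
  · subst hx
    rw [hb, PEquiv.single_apply]
  · rw [PEquiv.single_apply_of_ne (Ne.symm hx)]
    exact Option.not_isSome_iff_eq_none.mp (mt (isSome_iff x).mp hx)

theorem PEquiv.vecMul_toMatrix_single {m n R : Type*} [Fintype m] [DecidableEq m]
    [DecidableEq n] [NonAssocSemiring R] (v : m → R) (i : m) (j : n) :
    Matrix.vecMul v (PEquiv.toMatrix (PEquiv.single i j) : Matrix m n R) =
      Pi.single j (v i) := by
  ext k
  simp only [Matrix.vecMul, dotProduct, PEquiv.toMatrix_apply, PEquiv.mem_single_iff]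
  rw [Finset.sum_eq_single i] <;> simp +contextual [Pi.single_apply]


/-- The rook matrix representation of a transitive set of partial permutations closed under
composition and inversion and containing a rank-one element is irreducible. -/
theorem rook_representation_irreducible {K : Type*} [Field K] [CharZero K]
    {α : Type*} [Fintype α] [DecidableEq α]
    (S : Set (α ≃. α))
    (htrans : ∀ f ∈ S, ∀ g ∈ S, f.trans g ∈ S)
    (hsymm : ∀ f ∈ S, f.symm ∈ S)
    (htransitive : ∀ x y : α, ∃ f ∈ S, f x = some y)
    (hrank1 : ∃ f ∈ S, (Finset.univ.filter fun x => (f x).isSome).card = 1)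
    (W : Submodule K (α → K))
    (hW : ∀ f ∈ S, ∀ v ∈ W, Matrix.vecMul v (PEquiv.toMatrix f : Matrix α α K) ∈ W) :
    W = ⊥ ∨ W = ⊤ := by
  obtain ⟨f, hf, hcard⟩ := hrank1
  obtain ⟨a, b, rfl⟩ := f.exists_eq_single_of_card_eq_one hcard
  have single_mem (x y : α) : PEquiv.single x y ∈ S := by
    obtain ⟨g, hg, hgx⟩ := htransitive x a
    obtain ⟨h, hh, hhb⟩ := htransitive b y
    have hmem := htrans _ (htrans g hg _ hf) h hh
    rwa [PEquiv.trans_single_of_mem b hgx, PEquiv.single_trans_of_mem x hhb] at hmem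
  refine or_iff_not_imp_left.mpr fun hne => ?_
  obtain ⟨v, hv, hv0⟩ := W.exists_mem_ne_zero_of_ne_bot hne
  obtain ⟨x, hx⟩ := Function.ne_iff.mp hv0
  refine eq_top_iff.mpr fun w _ => ?_
  rw [← Finset.univ_sum_single w]
  refine W.sum_mem fun y _ => ?_
  have hy := W.smul_mem (w y / v x) (hW _ (single_mem x y) v hv)
  rwa [PEquiv.vecMul_toMatrix_single, ← Pi.single_smul, smul_eq_mul, div_mul_cancel₀ _ hx] at hy
end

section
/- Let K be a field of characteristic zero, n a finite type with decidable equality, A an n × n matrix over K, and m ≥ 1 a natural number with A^(2m) = A^m. Then trace A = trace (A^(m+1)). -/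
/-- If `A` is a square matrix over a field of characteristic zero and `A ^ (2 * m) = A ^ m`
with `m ≥ 1`, then `A` and `A ^ (m + 1)` have the same trace. -/
theorem trace_eq_trace_pow_succ_of_pow_idem {K : Type*} [Field K] [CharZero K]
    {n : Type*} [Fintype n] [DecidableEq n]
    (A : Matrix n n K) (m : ℕ) (hm : 1 ≤ m) (h : A ^ (2 * m) = A ^ m) :
    A.trace = (A ^ (m + 1)).trace := by
  have hcomm : Commute A (1 - A ^ m) :=
    (Commute.one_right A).sub_right (Commute.self_pow A m)
  have hzero : A ^ m * (1 - A ^ m) = 0 := by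
    rw [mul_sub, mul_one, ← pow_add, ← two_mul, h, sub_self]
  have hnil : IsNilpotent (A - A ^ (m + 1)) := by
    refine ⟨m, ?_⟩
    rw [pow_succ', ← mul_one_sub, hcomm.mul_pow,
      ← mul_pow_sub_one (Nat.one_le_iff_ne_zero.mp hm) (1 - A ^ m), ← mul_assoc, hzero, zero_mul]
  have htrace := (Matrix.isNilpotent_trace_of_isNilpotent hnil).eq_zero
  rwa [Matrix.trace_sub, sub_eq_zero] at htrace
end

section
/- Let M be a finite monoid in which any two idempotents commute, and let R be the submonoid of M consisting exactly of the regular elements (s is regular if s*t*s = s and t*s*t = t for some t; by commuting idempotents the regular elements are closed under multiplication and form a finite inverse monoid). Equip R with a partial order (with decidable equality and locally finite order structure) whose relation satisfies: u ≤ v iff u = e*v for some idempotent e ∈ R; let μ be its Möbius function with values in a field K of characteristic zero, and in MonoidAlgebra K R set ⌊u⌋ = Σ_{t ≤ u} μ(t,u)·t. Define ν : M → MonoidAlgebra K R by ν(s) = Σ ⌊u⌋, the sum over all u ∈ R such that (the underlying element of) u equals e*s for some idempotent e ∈ M. Then ν is multiplicative, ν(s*t) = ν(s)·ν(t) for all s,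 t ∈ M, and ν(u) equals the basis element u for every u ∈ R. -/
open scoped Classical

section CommutingIdempotents

variable {M : Type*} [Monoid M]

theorem mul_mul_eq_of_eq_idempotent_mul
    (hcomm : ∀ e f : M, e * e = e → f * f = f → e * f = f * e) {e s u x : M}
    (he : e * e = e) (hu : u = e * s) (hx : u * x * u = u) : u * x * s = u := by
  have hux : u * x * (u * x) = u * x := by rw [← mul_assoc, hx]
  have heu : e * u = u := by rw [hu, ← mul_assoc, he]
  have h : u * x * e = u * x := by rw [hcomm _ _ hux he, ← mul_assoc, heu]
  calc u * x * s = u * x * e * s := by rw [h]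
    _ = u := by rw [mul_assoc _ e s, ← hu, hx]

/-- If `x` inverts `u`, `y` inverts `v`, `z` inverts `u * v` and the domain of `u` is the range
of `v`, then `u * v` and `u` have the same range. -/
theorem range_mul_eq_range
    (hcomm : ∀ e f : M, e * e = e → f * f = f → e * f = f * e) {u v x y z : M}
    (hx : u * x * u = u) (hz : u * v * z * (u * v) = u * v) (h : x * u = v * y) :
    u * v * z = u * x := by
  have hux : u * x * (u * x) = u * x := by rw [← mul_assoc, hx]
  have hwz : u * v * z * (u * v * z) = u * v * z := by rw [← mul_assoc, hz]
  have h1 : u * x * (u * v * z) = u * v * z := by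
    calc u * x * (u * v * z) = u * x * u * v * z := by simp only [mul_assoc]
      _ = _ := by rw [hx]
  have h2 : u * x = u * v * (y * x) := by
    calc u * x = u * (x * u) * x := by rw [← mul_assoc, hx]
      _ = _ := by rw [h]; simp only [mul_assoc]
  have h3 : u * v * z * (u * x) = u * x := by rw [h2, ← mul_assoc, hz]
  rw [← h1, hcomm _ _ hux hwz, h3]

theorem regular_of_mul_mul_eq {u x : M} (h : u * x * u = u) :
    ∃ t : M, u * t * u = u ∧ t * u * t = t := by
  refine ⟨x * u * x, ?_, ?_⟩
  · calc u * (x * u * x) * u = u * x * u * x * u := by simp only [mul_assoc]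
      _ = u := by rw [h, h]
  · calc x * u * x * u * (x * u * x) = x * (u * x * u * x * u) * x := by simp only [mul_assoc]
      _ = _ := by rw [h, h]

end CommutingIdempotents

/-- Möbius inversion for the formal sums `⌊u⌋ = ∑ t ≤ u, μ(t, u) t`. -/
theorem sum_le_sum_single_mu {α K : Type*} [Fintype α] [DecidableEq α] [PartialOrder α]
    [LocallyFiniteOrder α] [Field K] (a : α) :
    ∑ u ∈ Finset.univ.filter (· ≤ a), ∑ t ∈ Finset.univ.filter (· ≤ u),
      MonoidAlgebra.single t (IncidenceAlgebra.mu K t u) = MonoidAlgebra.single a (1 : K) := by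
  have hswap : ∑ u ∈ Finset.univ.filter (· ≤ a), ∑ t ∈ Finset.univ.filter (· ≤ u),
      MonoidAlgebra.single t (IncidenceAlgebra.mu K t u) =
      ∑ t : α, ∑ u ∈ Finset.Icc t a, MonoidAlgebra.single t (IncidenceAlgebra.mu K t u) := by
    refine Finset.sum_comm' fun u t => ?_
    simp [and_comm]
  rw [hswap, Finset.sum_eq_single a]
  · simp
  · intro t _ hta
    have h := IncidenceAlgebra.sum_Icc_mu_right (𝕜 := K) t a
    rw [if_neg hta] at h
    have h0 := map_sum (MonoidAlgebra.singleAddHom (R := K) t)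
      (fun u => IncidenceAlgebra.mu K t u) (Finset.Icc t a)
    simp only [MonoidAlgebra.singleAddHom_apply] at h0
    rw [← h0, h, MonoidAlgebra.single_zero]
  · simp

/-- A function on a finite poset is determined by its sums over principal lower sets. -/
theorem eq_of_sum_le_eq {α A : Type*} [Fintype α] [PartialOrder α] [DecidableLE α]
    [AddCommGroup A] {F G : α → A}
    (h : ∀ a, ∑ u ∈ Finset.univ.filter (· ≤ a), F u = ∑ u ∈ Finset.univ.filter (· ≤ a), G u) :
    F = G := by
  funext a
  induction a using WellFoundedLT.induction with
  | ind a ih =>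
    have hmem : a ∈ Finset.univ.filter (· ≤ a) := by simp
    have ha := h a
    rw [← Finset.add_sum_erase _ _ hmem, ← Finset.add_sum_erase _ _ hmem] at ha
    have hrest : ∑ u ∈ (Finset.univ.filter (· ≤ a)).erase a, F u =
        ∑ u ∈ (Finset.univ.filter (· ≤ a)).erase a, G u := by
      refine Finset.sum_congr rfl fun u hu => ih u ?_
      rw [Finset.mem_erase, Finset.mem_filter] at hu
      exact lt_of_le_of_ne hu.2.2 hu.1
    rw [hrest] at ha
    exact add_right_cancel ha

/-- Regular elements below `s * t` factor uniquely as a composable product of a regular element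
below `s` and a regular element below `t`. -/
theorem sum_composable_mul_eq {M A : Type*} [Monoid M] [Fintype M] [AddCommMonoid A]
    (hcomm : ∀ e f : M, e * e = e → f * f = f → e * f = f * e)
    (R : Submonoid M)
    (hR : ∀ s : M, s ∈ R ↔ ∃ t : M, s * t * s = s ∧ t * s * t = t)
    [Fintype ↥R] [DecidableEq ↥R] (inv : ↥R → ↥R) (hinv : ∀ u, u * inv u * u = u) (φ : ↥R → A) (s t : M) :
    ∑ u ∈ Finset.univ.filter (fun u : ↥R => ∃ e : M, e * e = e ∧ (u : M) = e * s),
      ∑ v ∈ Finset.univ.filter (fun v : ↥R => ∃ e : M, e * e = e ∧ (v : M) = e * t),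
        (if inv u * u = v * inv v then φ (u * v) else 0) =
    ∑ w ∈ Finset.univ.filter (fun w : ↥R => ∃ e : M, e * e = e ∧ (w : M) = e * (s * t)),
      φ w := by
  have hinvM : ∀ u : ↥R, (u : M) * inv u * u = u := fun u => congrArg Subtype.val (hinv u)
  have hidem : ∀ u : ↥R, (u : M) * inv u * (u * inv u) = u * inv u := fun u => by
    rw [← mul_assoc, hinvM]
  have hidem' : ∀ u : ↥R, (inv u : M) * u * (inv u * u) = inv u * u := fun u => by
    rw [mul_assoc, ← mul_assoc (u : M), hinvM]
  have hbelow : ∀ (u : ↥R) (a : M), (∃ e : M, e * e = e ∧ (u : M) = e * a) →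
      (u : M) * inv u * a = u := fun u a ⟨e, he, hu⟩ =>
    mul_mul_eq_of_eq_idempotent_mul hcomm he hu (hinvM u)
  rw [← Finset.sum_product', ← Finset.sum_filter]
  refine Finset.sum_bij (fun p _ => p.1 * p.2) ?_ ?_ ?_ (fun _ _ => rfl)
  · rintro ⟨u, v⟩ hp
    simp only [Finset.mem_filter, Finset.mem_product, Finset.mem_univ, true_and] at hp ⊢
    obtain ⟨⟨⟨e, he, hu⟩, hv⟩, huv⟩ := hp
    have huvM : (inv u : M) * u = v * inv v := congrArg Subtype.val huv
    refine ⟨e, he, ?_⟩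
    calc ((u * v : ↥R) : M) = u * (v * inv v * t) := by rw [hbelow v t hv]; rfl
      _ = u * inv u * u * t := by rw [← huvM]; simp only [mul_assoc]
      _ = e * (s * t) := by rw [hinvM, hu, mul_assoc]
  · rintro ⟨u, v⟩ hp ⟨u', v'⟩ hp' heq
    simp only [Finset.mem_filter, Finset.mem_product, Finset.mem_univ, true_and] at hp hp' heq
    obtain ⟨⟨hu, hv⟩, huv⟩ := hp
    obtain ⟨⟨hu', hv'⟩, huv'⟩ := hp'
    have huvM : (inv u : M) * u = v * inv v := congrArg Subtype.val huv
    have huvM' : (inv u' : M) * u' = v' * inv v' := congrArg Subtype.val huv'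
    have heqM : (u : M) * v = u' * v' := congrArg Subtype.val heq
    have hz : (u : M) * v * inv (u * v) * (u * v) = u * v := hinvM (u * v)
    have hrange := range_mul_eq_range hcomm (hinvM u) hz huvM
    have hrange' := range_mul_eq_range hcomm (z := (inv (u * v) : M)) (hinvM u')
      (by rw [← heqM]; exact hz) huvM'
    rw [← heqM, hrange] at hrange'
    have huu : u = u' := by
      apply Subtype.ext
      rw [← hbelow u s hu, ← hbelow u' s hu', hrange']
    subst huu
    have hvv : v = v' := by
      apply Subtype.ext
      rw [← hbelow v t hv, ← hbelow v' t hv', ← huvM, ← huvM']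
    rw [hvv]
  · intro w hw
    simp only [Finset.mem_filter, Finset.mem_univ, true_and] at hw
    have hwst := hbelow w _ hw
    have hureg : (w : M) * inv w * s * (t * inv w) * (w * inv w * s) = w * inv w * s := by
      calc (w : M) * inv w * s * (t * inv w) * (w * inv w * s)
          = w * inv w * (s * t) * inv w * (w * inv w) * s := by simp only [mul_assoc]
        _ = _ := by rw [hwst, hidem]
    let u : ↥R := ⟨w * inv w * s, (hR _).2 (regular_of_mul_mul_eq hureg)⟩
    have hu : (u : M) = w * inv w * s := rfl
    have hut : (u : M) * t = w := by rw [hu, mul_assoc, hwst]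
    have huw : (u : M) * inv u = w * inv w := by
      have h1 : (w : M) * inv w * (u * inv u) = u * inv u := by
        rw [hu]
        calc (w : M) * inv w * (w * inv w * s * inv u)
            = w * inv w * (w * inv w) * s * inv u := by simp only [mul_assoc]
          _ = _ := by rw [hidem]
      have h2 : (u : M) * inv u * (w * inv w) = w * inv w := by
        calc (u : M) * inv u * (w * inv w) = u * inv u * u * t * inv w := by
              nth_rw 1 [← hut]; simp only [mul_assoc]
          _ = _ := by rw [hinvM, hut]
      rw [← h1, hcomm _ _ (hidem w) (hidem u), h2]
    let v : ↥R := inv u * w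
    have hv : (v : M) = inv u * w := rfl
    have huv : inv u * u = v * inv v := by
      apply Subtype.ext
      change (inv u : M) * u = v * inv v
      have h1 : (inv u : M) * u * (v * inv v) = v * inv v := by
        rw [hv, ← hut]
        calc (inv u : M) * u * (inv u * (u * t) * inv v)
            = inv u * (u * inv u * u) * t * inv v := by simp only [mul_assoc]
          _ = _ := by rw [hinvM]; simp only [mul_assoc]
      have h2 : (inv u : M) * u = v * (inv w * u) := by
        calc (inv u : M) * u = inv u * (u * inv u * u) := by rw [hinvM]
          _ = _ := by rw [huw, hv]; simp only [mul_assoc]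
      have h3 : (v : M) * inv v * (inv u * u) = inv u * u := by
        rw [h2, ← mul_assoc, hinvM]
      rw [← h1, hcomm _ _ (hidem' u) (hidem v), h3]
    refine ⟨(u, v), ?_, ?_⟩
    · simp only [Finset.mem_filter, Finset.mem_product, Finset.mem_univ, true_and]
      refine ⟨⟨⟨_, hidem w, hu⟩, ⟨_, hidem' u, ?_⟩⟩, huv⟩
      rw [mul_assoc, hut, hv]
    · apply Subtype.ext
      change (u : M) * (inv u * w) = w
      rw [← mul_assoc, huw, hinvM]

/-- For a finite monoid `M` with commuting idempotents, the map `ν` sending `s ∈ M` to the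
sum of the groupoid basis elements `⌊u⌋` over the regular elements `u` of the form
`u = e * s` with `e` idempotent is a multiplicative retraction of the monoid algebra of `M`
onto the monoid algebra of the inverse monoid `R` of regular elements. -/
theorem nu_is_multiplicative_retraction {M : Type*} [Monoid M] [Fintype M]
    (hcomm : ∀ e f : M, e * e = e → f * f = f → e * f = f * e)
    (R : Submonoid M)
    (hR : ∀ s : M, s ∈ R ↔ ∃ t : M, s * t * s = s ∧ t * s * t = t)
    [Fintype ↥R] [DecidableEq ↥R] [PartialOrder ↥R] [LocallyFiniteOrder ↥R]
    (horder : ∀ u v : ↥R, u ≤ v ↔ ∃ e : ↥R, e * e = e ∧ u = e * v)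
    (K : Type*) [Field K] [CharZero K]
    (floor : ↥R → MonoidAlgebra K ↥R)
    (hfloor : ∀ u : ↥R, floor u =
      ∑ t ∈ Finset.univ.filter (· ≤ u),
        MonoidAlgebra.single t (IncidenceAlgebra.mu K t u))
    (ν : M → MonoidAlgebra K ↥R)
    (hν : ∀ s : M, ν s =
      ∑ u ∈ Finset.univ.filter (fun u : ↥R => ∃ e : M, e * e = e ∧ (u : M) = e * s),
        floor u) :
    (∀ s t : M, ν (s * t) = ν s * ν t) ∧
    (∀ u : ↥R, ν u = MonoidAlgebra.single u 1) := by
  have hexists : ∀ u : ↥R, ∃ x : ↥R, u * x * u = u := fun u => by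
    obtain ⟨x, hx, hx'⟩ := (hR u).1 u.2
    exact ⟨⟨x, (hR x).2 ⟨u, hx', hx⟩⟩, Subtype.ext hx⟩
  choose inv hinv using hexists
  have hbelow : ∀ u v : ↥R, (∃ e : M, e * e = e ∧ (u : M) = e * v) ↔ u ≤ v := by
    intro u v
    rw [horder]
    constructor
    · rintro ⟨e, he, hu⟩
      have he' : e * e * e = e := by rw [he, he]
      exact ⟨⟨e, (hR e).2 ⟨e, he', he'⟩⟩, Subtype.ext he, Subtype.ext hu⟩
    · rintro ⟨e, he, hu⟩
      exact ⟨e, congrArg Subtype.val he, congrArg Subtype.val hu⟩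
  have hνfloor : ∀ v : ↥R, ν v = ∑ u ∈ Finset.univ.filter (· ≤ v), floor u := fun v => by
    rw [hν]
    simp only [hbelow]
  have hνR : ∀ u : ↥R, ν u = MonoidAlgebra.single u 1 := fun u => by
    rw [hνfloor, Finset.sum_congr rfl fun u _ => hfloor u, sum_le_sum_single_mu]
  have hcomposable := sum_composable_mul_eq hcomm R hR inv hinv floor
  have hfloor_mul : (fun p : ↥R × ↥R => floor p.1 * floor p.2) =
      fun p => if inv p.1 * p.1 = p.2 * inv p.2 then floor (p.1 * p.2) else 0 := by
    refine eq_of_sum_le_eq fun ⟨a, b⟩ => ?_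
    have hfilter : Finset.univ.filter (· ≤ (a, b)) =
        Finset.univ.filter (· ≤ a) ×ˢ Finset.univ.filter (· ≤ b) := by
      ext p
      simp [Prod.le_def]
    rw [hfilter, Finset.sum_product, Finset.sum_product]
    have hab := hcomposable a b
    rw [← hν, ← Submonoid.coe_mul, hνR] at hab
    simp only [hbelow] at hab
    rw [hab, ← Finset.sum_mul_sum, ← hνfloor, ← hνfloor, hνR, hνR,
      MonoidAlgebra.single_mul_single, one_mul]
  refine ⟨fun s t => ?_, hνR⟩
  rw [hν (s * t), ← hcomposable s t, hν s, hν t, Finset.sum_mul_sum]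
  exact Finset.sum_congr rfl fun u _ => Finset.sum_congr rfl fun v _ =>
    (congrFun hfloor_mul (u, v)).symm
end

section
/- Let M be a finite monoid in which any two idempotents commute and let K be a field of characteristic zero. Then the dimension over K of the Jacobson radical of the monoid algebra MonoidAlgebra K M equals the number of non-regular elements of M: finrank_K Rad(K[M]) = card {s ∈ M | s is not regular}. -/
section FiniteMonoid

variable {M : Type*} [Monoid M]

/-- The number of left multiples of an element of a monoid. -/
noncomputable def leftMultiplesCard (m : M) : ℕ := (Set.range (· * m)).ncard

variable [Finite M]

theorem leftMultiplesCard_mul_lt_or_exists (k m : M) :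
    leftMultiplesCard (k * m) < leftMultiplesCard m ∨ ∃ l, l * (k * m) = m := by
  have hsub : Set.range (· * (k * m)) ⊆ Set.range (· * m) := by
    rintro _ ⟨a, rfl⟩
    exact ⟨a * k, mul_assoc _ _ _⟩
  rcases (Set.ncard_le_ncard hsub (Set.toFinite _)).lt_or_eq with h | h
  · exact .inl h
  · right
    have : m ∈ Set.range (· * (k * m)) := by
      rw [Set.eq_of_subset_of_ncard_le hsub h.ge (Set.toFinite _)]
      exact ⟨1, one_mul m⟩
    exact this

theorem leftMultiplesCard_mul_le (k m : M) :
    leftMultiplesCard (k * m) ≤ leftMultiplesCard m := by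
  refine Set.ncard_le_ncard ?_ (Set.toFinite _)
  rintro _ ⟨a, rfl⟩
  exact ⟨a * k, mul_assoc _ _ _⟩

theorem exists_pow_succ_isIdempotentElem (x : M) : ∃ n : ℕ, IsIdempotentElem (x ^ (n + 1)) := by
  obtain ⟨a, b, hab, h⟩ : ∃ a b : ℕ, a < b ∧ x ^ a = x ^ b := by
    obtain ⟨a, b, hne, h⟩ := Finite.exists_ne_map_eq_of_infinite (fun n : ℕ ↦ x ^ n)
    rcases hne.lt_or_gt with h' | h'
    exacts [⟨a, b, h', h⟩, ⟨b, a, h', h.symm⟩]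
  obtain ⟨p, rfl⟩ := Nat.exists_eq_add_of_lt hab
  have key (k : ℕ) : x ^ (a + k * (p + 1)) = x ^ a := by
    induction k with
    | zero => simp
    | succ k ih =>
      rw [show a + (k + 1) * (p + 1) = (a + p + 1) + k * (p + 1) by ring, pow_add, ← h, ← pow_add,
        ih]
  refine ⟨(a + 1) * (p + 1) - 1, ?_⟩
  rw [Nat.sub_add_cancel (Nat.mul_pos a.succ_pos p.succ_pos)]
  obtain ⟨c, hc⟩ : ∃ c, (a + 1) * (p + 1) = a + c := ⟨a * p + p + 1, by ring⟩
  rw [IsIdempotentElem, ← pow_add]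
  conv_lhs => rw [hc, show a + c + (a + c) = a + (a + c) + c by ring, ← hc, pow_add, key, ← pow_add,
    ← hc]

/-- An element with a left inverse in a local monoid `e M e` has a right inverse. -/
theorem exists_mul_eq_of_mul_eq {e t v : M} (het : e * t = t) (hte : t * e = t) (hv : v * t = e) :
    ∃ x, t * x = e := by
  have hee : e * e = e := by
    rw [show e * e = v * (t * e) by rw [← mul_assoc, hv], hte, hv]
  have hinj : Function.Injective (fun x : {x : M // e * x = x} ↦
      (⟨t * x, by rw [← mul_assoc, het]⟩ : {x : M // e * x = x})) := by
    rintro ⟨x, hx⟩ ⟨y, hy⟩ h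
    have h' : t * x = t * y := congrArg Subtype.val h
    refine Subtype.ext ?_
    change x = y
    rw [← hx, ← hy, ← hv, mul_assoc, mul_assoc, h']
  obtain ⟨⟨x, _⟩, hx⟩ := Finite.surjective_of_injective hinj ⟨e, hee⟩
  exact ⟨x, congrArg Subtype.val hx⟩

/-- If idempotents commute, every `m` is fixed by an idempotent `e` such that left multiplication
by an element of `M e` that is not left equivalent to `e` strictly lowers the left class of `m`. -/
theorem exists_idempotent_mul_eq_of_comm
    (hcomm : ∀ e f : M, e * e = e → f * f = f → e * f = f * e) (m : M) :
    ∃ e : M, e * e = e ∧ e * m = m ∧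
      ∀ s k : M, k * (s * m) = m → ∃ v, v * s = e := by
  obtain ⟨e, ⟨hee, hem⟩, hmin⟩ :=
    (Set.toFinite {e : M | e * e = e ∧ e * m = m}).exists_minimalFor leftMultiplesCard _
      ⟨1, one_mul 1, one_mul m⟩
  refine ⟨e, hee, hem, fun s k h ↦ ?_⟩
  obtain ⟨n, hn⟩ := exists_pow_succ_isIdempotentElem (k * s)
  set g := (k * s) ^ (n + 1) with hg
  have hgm : g * m = m := by
    have (j : ℕ) : (k * s) ^ j * m = m := by
      induction j with
      | zero => simp
      | succ j ih => rw [pow_succ, mul_assoc, mul_assoc k, h, ih]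
    exact this _
  have hge := hcomm g e hn hee
  have hgg : g * g = g := hn
  have heg : e * g = e := by
    rcases leftMultiplesCard_mul_lt_or_exists g e with hlt | ⟨l, hl⟩
    · refine absurd (hmin ⟨?_, ?_⟩ hlt.le) (not_le.2 hlt)
      · rw [mul_assoc, ← mul_assoc e, ← hge, mul_assoc g, hee, ← mul_assoc, hgg]
      · rw [mul_assoc, hem, hgm]
    · rw [← hl, mul_assoc l, mul_assoc g, ← hge, ← mul_assoc g, hgg]
  exact ⟨e * (k * s) ^ n * k, by rw [mul_assoc, mul_assoc, ← pow_succ, ← hg, heg]⟩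

end FiniteMonoid

section Regular

variable {M : Type*} [Monoid M]

/-- If idempotents commute, the idempotent `e` left equivalent to a regular element `u` is
unique. -/
theorem eq_mul_of_left_equiv (hcomm : ∀ e f : M, e * e = e → f * f = f → e * f = f * e)
    {e u v t : M} (hee : e * e = e) (hue : u * e = u) (hv : v * u = e)
    (ht : u * t * u = u) : e = t * u := by
  have h1 : e * (t * u) = e := by rw [← hv, mul_assoc, ← mul_assoc u, ht]
  have h2 : t * u * e = t * u := by rw [mul_assoc, hue]
  rw [← h2, ← hcomm e (t * u) hee (by rw [← mul_assoc, mul_assoc t, mul_assoc t, ht]), h1]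

theorem mul_mul_mul_eq_iff (hcomm : ∀ e f : M, e * e = e → f * f = f → e * f = f * e)
    {u v : M} (huv : u * v * u = u) (hvu : v * u * v = v) (s : M) :
    v * u * (v * s) * (v * u) = v * u ↔ s * (v * u) = u := by
  rw [← mul_assoc (v * u) v s, hvu]
  constructor
  · intro h
    have h1 : u * v * (s * v) = u * v := by
      calc u * v * (s * v) = u * v * (s * (v * u * v)) := by rw [hvu]
        _ = u * (v * s * (v * u)) * v := by simp only [mul_assoc]
        _ = u * v := by rw [h, ← mul_assoc, huv]
    have h2 : s * v * (u * v) = s * v := by rw [← mul_assoc, mul_assoc s, mul_assoc s, hvu]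
    have h3 : s * v * (s * v) = s * v := by
      calc s * v * (s * v) = s * v * (u * v) * (s * v) := by rw [h2]
        _ = s * v * (u * v * (s * v)) := mul_assoc _ _ _
        _ = s * v := by rw [h1, h2]
    have h4 : u * v * (u * v) = u * v := by rw [← mul_assoc, huv]
    have h5 : s * v = u * v := by rw [← h2, hcomm _ _ h3 h4, h1]
    rw [← mul_assoc, h5, huv]
  · intro h
    rw [mul_assoc, h]

theorem leftMultiplesCard_lt_of_mul_eq [Finite M]
    (hcomm : ∀ e f : M, e * e = e → f * f = f → e * f = f * e)
    {s s' u u' : M} (hs : s * s' * s = s) (hu : u * u' * u = u)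
    (h : s * (u' * u) = u) (hne : u ≠ s) : leftMultiplesCard u < leftMultiplesCard s := by
  have hes : s' * s * (s' * s) = s' * s := by rw [← mul_assoc, mul_assoc s', mul_assoc s', hs]
  have heu : u' * u * (u' * u) = u' * u := by rw [← mul_assoc, mul_assoc u', mul_assoc u', hu]
  have hus : u * s' * s = u := by
    rw [mul_assoc, ← h, mul_assoc, hcomm _ _ heu hes, ← mul_assoc, ← mul_assoc s, hs]
  rcases leftMultiplesCard_mul_lt_or_exists (u * s') s with hlt | ⟨l, hl⟩
  · rwa [hus] at hlt
  · rw [hus] at hl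
    refine absurd ?_ hne
    rw [← h]
    conv_lhs => rw [← hl, mul_assoc, ← mul_assoc u, hu]
    exact hl

end Regular

namespace MonoidAlgebra

section Coefficients

variable {K M : Type*} [Field K] [Monoid M] [Fintype M] [DecidableEq M]

theorem coeff_mul_single_one_eq_sum (x : MonoidAlgebra K M) (m u : M) :
    (x * single m 1).coeff u = ∑ s, if s * m = u then x.coeff s else 0 := by
  rw [coeff_mul, Finsupp.sum_fintype _ _ (by simp)]
  simp

theorem coeff_single_one_mul_mul_eq_sum (x : MonoidAlgebra K M) (a b u : M) :
    (single a 1 * x * single b 1).coeff u = ∑ s, if a * s * b = u then x.coeff s else 0 := by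
  induction x using induction_linear with
  | zero => simp
  | add x y hx hy =>
    simp only [mul_add, add_mul, coeff_add, Finsupp.add_apply, hx, hy, ← Finset.sum_add_distrib]
    exact Finset.sum_congr rfl fun s _ ↦ by split_ifs <;> simp
  | single m r =>
    rw [Finset.sum_eq_single m (fun s _ hs ↦ by simp [hs.symm]) (by simp)]
    simp [Finsupp.single_apply]

theorem coeff_mul_eq_sum_coeff_mul_single (x b : MonoidAlgebra K M) (u : M) :
    (x * b).coeff u = ∑ m, (x * single m 1).coeff u * b.coeff m := by
  rw [coeff_mul, Finsupp.sum_comm, Finsupp.sum_fintype _ _ (by simp)]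
  refine Finset.sum_congr rfl fun m _ ↦ ?_
  rw [coeff_mul_single_one_eq_sum, Finsupp.sum_fintype _ _ (by simp), Finset.sum_mul]
  exact Finset.sum_congr rfl fun s _ ↦ by split_ifs <;> simp

theorem exists_mul_eq_of_coeff_mul_single_ne_zero {x : MonoidAlgebra K M} {m u : M}
    (h : (x * single m 1).coeff u ≠ 0) : ∃ s, x.coeff s ≠ 0 ∧ s * m = u := by
  rw [coeff_mul_single_one_eq_sum] at h
  obtain ⟨s, -, hs⟩ := Finset.exists_ne_zero_of_sum_ne_zero h
  by_cases hsm : s * m = u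
  · exact ⟨s, by simpa [hsm] using hs, hsm⟩
  · simp [hsm] at hs

/-- The matrix, on the group of units of the local monoid `e M e`, of left multiplication by an
element of the monoid algebra, ignoring the components outside that group. -/
noncomputable def unitsMatrix (e : M) (x : MonoidAlgebra K M) :
    Matrix {t : M // e * t = t ∧ t * e = t ∧ ∃ v, v * t = e}
      {t : M // e * t = t ∧ t * e = t ∧ ∃ v, v * t = e} K :=
  fun t t' ↦ (x * single t'.1 1).coeff t.1

theorem unitsMatrix_mul {e : M} (x y : MonoidAlgebra K M) (hy : single e 1 * y = y) :
    unitsMatrix e (x * y) = unitsMatrix e x * unitsMatrix e y := by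
  ext ⟨t, het, hte, v, hv⟩ t'
  rw [Matrix.mul_apply]
  change (x * y * single t'.1 1).coeff t = ∑ m : {t : M // e * t = t ∧ t * e = t ∧ ∃ v, v * t = e},
    (x * single m.1 1).coeff t * (y * single t'.1 1).coeff m.1
  rw [mul_assoc, coeff_mul_eq_sum_coeff_mul_single]
  refine .trans ?_ (Finset.sum_subtype {t : M | e * t = t ∧ t * e = t ∧ ∃ v, v * t = e} (by simp)
    (fun m ↦ (x * single m 1).coeff t * (y * single t'.1 1).coeff m))
  symm
  refine Finset.sum_subset (Finset.subset_univ _) fun m _ hm ↦ ?_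
  by_contra hne
  refine hm ?_
  have hee : e * e = e := by
    nth_rw 1 [← hv]
    rw [mul_assoc, hte, hv]
  obtain ⟨r, -, hr⟩ := exists_mul_eq_of_coeff_mul_single_ne_zero (left_ne_zero_of_mul hne)
  have hm' := right_ne_zero_of_mul hne
  obtain ⟨s, -, hs⟩ := exists_mul_eq_of_coeff_mul_single_ne_zero hm'
  rw [← hy, mul_assoc, coeff_mul_eq_sum_coeff_mul_single] at hm'
  obtain ⟨q, -, hq⟩ := Finset.exists_ne_zero_of_sum_ne_zero hm'
  have hq' := left_ne_zero_of_mul hq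
  rw [single_mul_single, coeff_single, Finsupp.single_apply_ne_zero] at hq'
  simp only [Finset.mem_filter, Finset.mem_univ, true_and]
  refine ⟨?_, ?_, v * r, ?_⟩
  · rw [hq'.1, ← mul_assoc, hee]
  · rw [← hs, mul_assoc, t'.2.2.1]
  · rw [mul_assoc, hr, hv]

theorem unitsMatrix_pow {e : M} (y : MonoidAlgebra K M) (hy : single e 1 * y = y) (n : ℕ) :
    unitsMatrix e (y ^ n) = unitsMatrix e y ^ n := by
  induction n with
  | zero =>
    ext t t'
    simp [unitsMatrix, Matrix.one_apply, Finsupp.single_apply, Subtype.ext_iff, eq_comm]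
  | succ n ih => rw [pow_succ, pow_succ, unitsMatrix_mul _ _ hy, ih]

theorem trace_unitsMatrix {e : M} (y : MonoidAlgebra K M) (hy : y * single e 1 = y) :
    (unitsMatrix e y).trace =
      Fintype.card {t : M // e * t = t ∧ t * e = t ∧ ∃ v, v * t = e} • y.coeff e := by
  rw [Matrix.trace, ← Finset.card_univ, ← Finset.sum_const]
  refine Finset.sum_congr rfl fun ⟨t, het, hte, v, hv⟩ _ ↦ ?_
  rw [Matrix.diag_apply, unitsMatrix, coeff_mul_single_one_eq_sum,
    Finset.sum_eq_single e, if_pos het]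
  · intro s _ hse
    split_ifs with hst
    · by_contra hne
      rw [← hy] at hne
      obtain ⟨r, -, rfl⟩ := exists_mul_eq_of_coeff_mul_single_ne_zero hne
      obtain ⟨z, hz⟩ := exists_mul_eq_of_mul_eq het hte hv
      apply hse
      have hee : e * e = e := by
        nth_rw 2 [← hz]
        rw [← mul_assoc, het, hz]
      calc r * e = r * e * e := by rw [mul_assoc, hee]
        _ = r * e * t * z := by rw [mul_assoc _ t, hz]
        _ = e := by rw [hst, hz]
    · rfl
  · simp

/-- In characteristic zero, the coefficient of `e` in a nilpotent element of the corner of the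
monoid algebra at the idempotent `e` vanishes. -/
theorem coeff_eq_zero_of_isNilpotent [CharZero K] {e : M} (hee : e * e = e)
    {y : MonoidAlgebra K M} (hey : single e 1 * y = y) (hye : y * single e 1 = y)
    (hy : IsNilpotent y) : y.coeff e = 0 := by
  obtain ⟨n, hn⟩ := hy
  have hnil : IsNilpotent (unitsMatrix e y) := by
    refine ⟨n, ?_⟩
    rw [← unitsMatrix_pow y hey, hn]
    ext t t'
    simp [unitsMatrix]
  have h := (Matrix.isNilpotent_trace_of_isNilpotent hnil).eq_zero
  rw [trace_unitsMatrix y hye, smul_eq_zero] at h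
  refine h.resolve_left ?_
  exact (Fintype.card_pos_iff.2 ⟨⟨e, hee, hee, e, hee⟩⟩).ne'

end Coefficients

section Radical

variable {K M : Type*} [Field K] [Monoid M] [Fintype M]

theorem isNilpotent_of_mem_jacobson {x : MonoidAlgebra K M}
    (hx : x ∈ Ideal.jacobson (⊥ : Ideal (MonoidAlgebra K M))) : IsNilpotent x := by
  have : Module.Finite K (MonoidAlgebra K M) := .of_basis (basis M K)
  have : IsArtinianRing (MonoidAlgebra K M) := .of_finite K _
  obtain ⟨n, hn⟩ := IsArtinianRing.isNilpotent_jacobson_bot (R := MonoidAlgebra K M)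
  refine ⟨n, ?_⟩
  have := Ideal.pow_mem_pow hx n
  rwa [hn] at this

theorem coeff_mul_single_eq_zero_of_mem_jacobson [CharZero K]
    (hcomm : ∀ e f : M, e * e = e → f * f = f → e * f = f * e) {x : MonoidAlgebra K M}
    (hx : x ∈ Ideal.jacobson (⊥ : Ideal (MonoidAlgebra K M))) {u v : M}
    (huv : u * v * u = u) (hvu : v * u * v = v) : (x * single (v * u) 1).coeff u = 0 := by
  classical
  have hee : v * u * (v * u) = v * u := by rw [← mul_assoc, hvu]
  have hmem : single (v * u * v) 1 * x * single (v * u) 1 ∈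
      Ideal.jacobson (⊥ : Ideal (MonoidAlgebra K M)) :=
    Ideal.mul_mem_right _ _ (Ideal.mul_mem_left _ _ hx)
  have h := coeff_eq_zero_of_isNilpotent hee (by simp [← mul_assoc, hvu])
    (by simp [mul_assoc, hee]) (isNilpotent_of_mem_jacobson hmem)
  rw [coeff_single_one_mul_mul_eq_sum] at h
  rw [coeff_mul_single_one_eq_sum]
  refine .trans ?_ h
  refine Finset.sum_congr rfl fun s _ ↦ ?_
  simp only [← mul_mul_mul_eq_iff hcomm huv hvu, mul_assoc (v * u) v s]

/-- If left multiplication by `x` strictly lowers left classes, then so does left multiplication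
by every left multiple of `x`, and `x` lies in the Jacobson radical. -/
theorem mem_jacobson_of_coeff_mul_single {x : MonoidAlgebra K M}
    (hx : ∀ m u : M, (x * single m 1).coeff u ≠ 0 →
      leftMultiplesCard u < leftMultiplesCard m) :
    x ∈ Ideal.jacobson (⊥ : Ideal (MonoidAlgebra K M)) := by
  classical
  rw [Ideal.mem_jacobson_iff]
  intro y
  have hyx (m u : M) (h : (y * x * single m 1).coeff u ≠ 0) :
      leftMultiplesCard u < leftMultiplesCard m := by
    rw [mul_assoc, coeff_mul_eq_sum_coeff_mul_single] at h
    obtain ⟨s, -, hs⟩ := Finset.exists_ne_zero_of_sum_ne_zero h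
    obtain ⟨r, -, rfl⟩ := exists_mul_eq_of_coeff_mul_single_ne_zero (left_ne_zero_of_mul hs)
    exact (leftMultiplesCard_mul_le r s).trans_lt (hx m s (right_ne_zero_of_mul hs))
  have hpow (n : ℕ) : ∀ m u : M, ((y * x) ^ n * single m 1).coeff u ≠ 0 →
      leftMultiplesCard u + n ≤ leftMultiplesCard m := by
    induction n with
    | zero =>
      intro m u h
      rw [pow_zero, one_mul, coeff_single, Finsupp.single_apply_ne_zero] at h
      rw [h.1, add_zero]
    | succ n ih =>
      intro m u h
      rw [pow_succ, mul_assoc, coeff_mul_eq_sum_coeff_mul_single] at h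
      obtain ⟨s, -, hs⟩ := Finset.exists_ne_zero_of_sum_ne_zero h
      have h1 := ih s u (left_ne_zero_of_mul hs)
      have h2 := hyx m s (right_ne_zero_of_mul hs)
      omega
  have hnil : IsNilpotent (y * x) := by
    refine ⟨leftMultiplesCard (1 : M) + 1, ?_⟩
    ext u
    by_contra h
    have := hpow _ 1 u (by rwa [← one_def, mul_one])
    omega
  obtain ⟨z, hz⟩ := hnil.isUnit_one_add.exists_left_inv
  refine ⟨z, ?_⟩
  rw [Ideal.mem_bot, ← hz]
  noncomm_ring

/-- The linear map on the monoid algebra sending `x` to the function whose value at a regular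
element `u` is the coefficient of `u` in `x * e`, where `e` is the idempotent left equivalent to
`u`. -/
noncomputable def regularCoeff (K M : Type*) [Field K] [Monoid M] : MonoidAlgebra K M →ₗ[K]
    ({s : M // ∃ t : M, s * t * s = s ∧ t * s * t = t} → K) where
  toFun x u := (x * single (u.2.choose * u.1) 1).coeff u.1
  map_add' x y := by ext u; simp [add_mul]
  map_smul' c x := by ext u; simp

theorem mem_ker_regularCoeff_iff_mem_jacobson [CharZero K]
    (hcomm : ∀ e f : M, e * e = e → f * f = f → e * f = f * e) (x : MonoidAlgebra K M) :
    x ∈ LinearMap.ker (regularCoeff K M) ↔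
      x ∈ Ideal.jacobson (⊥ : Ideal (MonoidAlgebra K M)) := by
  classical
  rw [LinearMap.mem_ker]
  constructor
  · intro hx
    refine mem_jacobson_of_coeff_mul_single fun m u hu ↦ ?_
    obtain ⟨e, hee, hem, he⟩ := exists_idempotent_mul_eq_of_comm hcomm m
    rw [← hem, ← mul_one (1 : K), ← single_mul_single, ← mul_assoc] at hu
    obtain ⟨s, hs, rfl⟩ := exists_mul_eq_of_coeff_mul_single_ne_zero hu
    refine (leftMultiplesCard_mul_lt_or_exists s m).resolve_right ?_
    rintro ⟨k, hk⟩
    obtain ⟨v, hv⟩ := he s k hk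
    have hse : s * e = s := by
      obtain ⟨r, -, rfl⟩ := exists_mul_eq_of_coeff_mul_single_ne_zero hs
      rw [mul_assoc, hee]
    have hreg : ∃ t : M, s * t * s = s ∧ t * s * t = t := by
      refine ⟨e * v, ?_, ?_⟩
      · rw [mul_assoc, mul_assoc e, hv, hee, hse]
      · rw [mul_assoc e, hv, hee, ← mul_assoc, hee]
    have h := congrFun hx ⟨s, hreg⟩
    refine hs ?_
    rwa [eq_mul_of_left_equiv hcomm hee hse hv hreg.choose_spec.1]
  · intro hx
    ext u
    exact coeff_mul_single_eq_zero_of_mem_jacobson hcomm hx u.2.choose_spec.1 u.2.choose_spec.2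

theorem regularCoeff_surjective
    (hcomm : ∀ e f : M, e * e = e → f * f = f → e * f = f * e) :
    Function.Surjective (regularCoeff K M) := by
  classical
  rw [← LinearMap.range_eq_top]
  have key (n : ℕ) : ∀ s : {s : M // ∃ t : M, s * t * s = s ∧ t * s * t = t},
      leftMultiplesCard s.1 < n → Pi.single s 1 ∈ LinearMap.range (regularCoeff K M) := by
    induction n with
    | zero => simp
    | succ n ih =>
      intro s hs
      have h : Pi.single s 1 = regularCoeff K M (single s.1 1) -
          ∑ u ∈ Finset.univ.erase s, regularCoeff K M (single s.1 1) u • Pi.single u (1 : K) := by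
        rw [eq_sub_iff_add_eq]
        conv_rhs => rw [← Finset.univ_sum_single (regularCoeff K M (single s.1 1)),
          ← Finset.add_sum_erase _ _ (Finset.mem_univ s)]
        congr 1
        · simp [regularCoeff, ← mul_assoc, s.2.choose_spec.1]
        · simp [← Pi.single_smul]
      rw [h]
      refine sub_mem (LinearMap.mem_range_self _ _) (sum_mem fun u hu ↦ ?_)
      by_cases hsu : s.1 * (u.2.choose * u.1) = u.1
      · refine Submodule.smul_mem _ _ (ih u ?_)
        have := leftMultiplesCard_lt_of_mul_eq hcomm s.2.choose_spec.1 u.2.choose_spec.1 hsu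
          (fun h ↦ Finset.ne_of_mem_erase hu (Subtype.ext h))
        omega
      · have : regularCoeff K M (single s.1 1) u = 0 := by
          simp [regularCoeff, hsu]
        simp [this]
  rw [eq_top_iff, ← (Pi.basisFun K _).span_eq, Submodule.span_le]
  rintro _ ⟨s, rfl⟩
  simpa using key _ s (Nat.lt_succ_self _)

end Radical

end MonoidAlgebra

/-- For a finite monoid with commuting idempotents and a field `K` of characteristic zero,
the dimension of the Jacobson radical of the monoid algebra equals the number of
non-regular elements of the monoid. -/
theorem finrank_jacobson_radical_eq_card_nonregular {M : Type*} [Monoid M] [Fintype M]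
    (hcomm : ∀ e f : M, e * e = e → f * f = f → e * f = f * e)
    (K : Type*) [Field K] [CharZero K] :
    Module.finrank K (Submodule.restrictScalars K
        (Ideal.jacobson (⊥ : Ideal (MonoidAlgebra K M)))) =
      Nat.card {s : M // ¬ ∃ t : M, s * t * s = s ∧ t * s * t = t} := by
  classical
  have heq : Submodule.restrictScalars K (Ideal.jacobson (⊥ : Ideal (MonoidAlgebra K M))) =
      LinearMap.ker (MonoidAlgebra.regularCoeff K M) := by
    ext x
    rw [MonoidAlgebra.mem_ker_regularCoeff_iff_mem_jacobson hcomm]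
    rfl
  have : Module.Finite K (MonoidAlgebra K M) := .of_basis (MonoidAlgebra.basis M K)
  have h := LinearMap.finrank_range_add_finrank_ker (MonoidAlgebra.regularCoeff K M)
  rw [LinearMap.range_eq_top.2 (MonoidAlgebra.regularCoeff_surjective hcomm), finrank_top,
    Module.finrank_fintype_fun_eq_card, Module.finrank_eq_card_basis (MonoidAlgebra.basis M K)] at h
  rw [heq, Nat.card_eq_fintype_card, Fintype.card_subtype_compl, ← h, Nat.add_sub_cancel_left]
end
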